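/- arXiv:2411.00117 — 2 statements merged into one kernel-verified Lean document; each statement's English description precedes it below -/
import Mathlib

section
/- Partially adjacent 1-TPTL is strictly more expressive than partially punctual metric temporal logic: (a) every PMTL formula has a language-equivalent PA-1-TPTL formula, and (b) the PA-1-TPTL formula ψ = ◇[a ∧ x.(◇(b ∧ T−x ∈ (1,2) ∧ ◇(c ∧ T−x ∈ (1,2))))] is not language-equivalent to any MTL[U_I,S_I] formula (hence to any PMTL formula). -/
namespace Paper

/-- An interval whose endpoints lie in `ℤ ∪ {−∞, ∞}`, each endpoint possibly
included (closed) or excluded (open). -/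
structure TInterval where
  lo : EReal
  hi : EReal
  loC : Bool
  hiC : Bool
  lo_int : lo = ⊥ ∨ lo = ⊤ ∨ ∃ z : ℤ, lo = ((z : ℝ) : EReal)
  hi_int : hi = ⊥ ∨ hi = ⊤ ∨ ∃ z : ℤ, hi = ((z : ℝ) : EReal)

/-- Membership of a real number in an interval. -/
def TInterval.mem (I : TInterval) (t : ℝ) : Prop :=
  (if I.loC then I.lo ≤ (t : EReal) else I.lo < (t : EReal)) ∧
  (if I.hiC then (t : EReal) ≤ I.hi else (t : EReal) < I.hi)

/-- The infimum of an interval. -/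
def TInterval.inf (I : TInterval) : EReal := I.lo
/-- The supremum of an interval. -/
def TInterval.sup (I : TInterval) : EReal := I.hi

/-- `I` and `I'` are non-adjacent: a nonzero supremum (resp. infimum) of one
is never the infimum (resp. supremum) of the other. -/
def NonAdj (I I' : TInterval) : Prop :=
  (I.sup = I'.inf → I.sup = 0) ∧ (I.inf = I'.sup → I.inf = 0)

/-- `I` and `I'` are positively non-adjacent. -/
def PosNonAdj (I I' : TInterval) : Prop :=
  (I.sup = I'.inf → I.sup ≤ 0) ∧ (I.inf = I'.sup → I.inf ≤ 0)

/-- `I` and `I'` are negatively non-adjacent. -/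
def NegNonAdj (I I' : TInterval) : Prop :=
  (I.sup = I'.inf → 0 ≤ I.sup) ∧ (I.inf = I'.sup → 0 ≤ I.inf)

/-- A (finite) timed word: a nonempty finite sequence of pairs of a nonempty
set of atomic propositions (coded as natural numbers) and a timestamp,
starting at time `0`, with monotone timestamps.  Positions are `0,…,n-1`. -/
structure TimedWord where
  n : ℕ
  npos : 0 < n
  σ : ℕ → Set ℕ
  τ : ℕ → ℝ
  sigma_nonempty : ∀ i < n, (σ i).Nonempty
  tau_nonneg : ∀ i < n, 0 ≤ τ i
  tau_zero : τ 0 = 0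
  tau_mono : ∀ i j, i ≤ j → j < n → τ i ≤ τ j

/-- Syntax of one-variable TPTL (with a single freeze variable `x`); the
constructors `or`, `ff`, `box` (`□`) and `boxm` (`⊟`) are included so that
negation normal form formulas can be expressed. -/
inductive TPTL where
  | atom : ℕ → TPTL
  | tt : TPTL
  | ff : TPTL
  | and : TPTL → TPTL → TPTL
  | or : TPTL → TPTL → TPTL
  | not : TPTL → TPTL
  | until : TPTL → TPTL → TPTL
  | since : TPTL → TPTL → TPTL
  | box : TPTL → TPTL
  | boxm : TPTL → TPTL
  | freeze : TPTL → TPTL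
  | constr : TInterval → TPTL

/-- Semantics of 1-TPTL at a position `i` with valuation `ν` of the freeze
variable (strict until/since). -/
def TPTL.sat (ρ : TimedWord) : TPTL → ℕ → ℝ → Prop
  | .atom a, i, _ => a ∈ ρ.σ i
  | .tt, _, _ => True
  | .ff, _, _ => False
  | .and φ ψ, i, ν => φ.sat ρ i ν ∧ ψ.sat ρ i ν
  | .or φ ψ, i, ν => φ.sat ρ i ν ∨ ψ.sat ρ i ν
  | .not φ, i, ν => ¬ φ.sat ρ i ν
  | .until φ ψ, i, ν =>
      ∃ j, i < j ∧ j < ρ.n ∧ ψ.sat ρ j ν ∧ ∀ k, i < k → k < j → φ.sat ρ k ν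
  | .since φ ψ, i, ν =>
      ∃ j, j < i ∧ ψ.sat ρ j ν ∧ ∀ k, j < k → k < i → φ.sat ρ k ν
  | .box φ, i, ν => ∀ j, i < j → j < ρ.n → φ.sat ρ j ν
  | .boxm φ, i, ν => ∀ j, j < i → φ.sat ρ j ν
  | .freeze φ, i, _ => φ.sat ρ i (ρ.τ i)
  | .constr I, i, ν => I.mem (ρ.τ i - ν)

/-- `ρ ⊨ φ` : satisfaction at the first position with the valuation `0`. -/
def TPTL.Models (ρ : TimedWord) (φ : TPTL) : Prop := φ.sat ρ 0 0

/-- Negation normal form: negation is applied to atomic propositions only. -/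
def TPTL.IsNNF : TPTL → Prop
  | .not (.atom _) => True
  | .not _ => False
  | .and φ ψ => φ.IsNNF ∧ ψ.IsNNF
  | .or φ ψ => φ.IsNNF ∧ ψ.IsNNF
  | .until φ ψ => φ.IsNNF ∧ ψ.IsNNF
  | .since φ ψ => φ.IsNNF ∧ ψ.IsNNF
  | .box φ => φ.IsNNF
  | .boxm φ => φ.IsNNF
  | .freeze φ => φ.IsNNF
  | _ => True

/-- The intervals of timing constraints of `φ` that are not within the scope
of a (nested) freeze quantifier. -/
def TPTL.freeIntervals : TPTL → List TInterval
  | .constr I => [I]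
  | .freeze _ => []
  | .and φ ψ => φ.freeIntervals ++ ψ.freeIntervals
  | .or φ ψ => φ.freeIntervals ++ ψ.freeIntervals
  | .until φ ψ => φ.freeIntervals ++ ψ.freeIntervals
  | .since φ ψ => φ.freeIntervals ++ ψ.freeIntervals
  | .not φ => φ.freeIntervals
  | .box φ => φ.freeIntervals
  | .boxm φ => φ.freeIntervals
  | _ => []

/-- Every pair of intervals of timing constraints lying within the scope of
the same freeze quantifier satisfies the relation `R`. -/
def TPTL.ScopedPairs (R : TInterval → TInterval → Prop) : TPTL → Prop
  | .freeze φ =>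
      (∀ I ∈ φ.freeIntervals, ∀ I' ∈ φ.freeIntervals, R I I') ∧
        φ.ScopedPairs R
  | .and φ ψ => φ.ScopedPairs R ∧ ψ.ScopedPairs R
  | .or φ ψ => φ.ScopedPairs R ∧ ψ.ScopedPairs R
  | .until φ ψ => φ.ScopedPairs R ∧ ψ.ScopedPairs R
  | .since φ ψ => φ.ScopedPairs R ∧ ψ.ScopedPairs R
  | .not φ => φ.ScopedPairs R
  | .box φ => φ.ScopedPairs R
  | .boxm φ => φ.ScopedPairs R
  | _ => True

/-- Non-adjacent 1-TPTL (on formulas in negation normal form). -/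
def TPTL.IsNA (φ : TPTL) : Prop := φ.ScopedPairs NonAdj
/-- Positively non-adjacent 1-TPTL (`NA⁺-1-TPTL`). -/
def TPTL.IsNAp (φ : TPTL) : Prop := φ.ScopedPairs PosNonAdj
/-- Negatively non-adjacent 1-TPTL (`NA⁻-1-TPTL`). -/
def TPTL.IsNAm (φ : TPTL) : Prop := φ.ScopedPairs NegNonAdj
/-- Partially adjacent 1-TPTL (`PA-1-TPTL`). -/
def TPTL.IsPA (φ : TPTL) : Prop := φ.IsNAp ∨ φ.IsNAm

/-- Syntax of `MTL[U_I, S_I]` over atomic propositions coded as naturals. -/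
inductive MTL where
  | atom : ℕ → MTL
  | tt : MTL
  | and : MTL → MTL → MTL
  | not : MTL → MTL
  | until : TInterval → MTL → MTL → MTL
  | since : TInterval → MTL → MTL → MTL

/-- Pointwise semantics of MTL on timed words (strict until/since). -/
def MTL.sat (ρ : TimedWord) : MTL → ℕ → Prop
  | .atom a, i => a ∈ ρ.σ i
  | .tt, _ => True
  | .and φ ψ, i => φ.sat ρ i ∧ ψ.sat ρ i
  | .not φ, i => ¬ φ.sat ρ i
  | .until I φ ψ, i =>
      ∃ j, i < j ∧ j < ρ.n ∧ ψ.sat ρ j ∧ I.mem (ρ.τ j - ρ.τ i) ∧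
        ∀ k, i < k → k < j → φ.sat ρ k
  | .since I φ ψ, i =>
      ∃ j, j < i ∧ ψ.sat ρ j ∧ I.mem (ρ.τ i - ρ.τ j) ∧
        ∀ k, j < k → k < i → φ.sat ρ k

/-- `ρ ⊨ φ`. -/
def MTL.Models (ρ : TimedWord) (φ : MTL) : Prop := φ.sat ρ 0

/-- A non-punctual interval `⟨l,u⟩` : `l < u`. -/
def TInterval.NonPunctual (I : TInterval) : Prop := I.lo < I.hi

/-- Endpoints lie in `ℕ ∪ {0,∞}`. -/
def TInterval.NatEnds (I : TInterval) : Prop :=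
  ((∃ m : ℕ, I.lo = ((m : ℝ) : EReal)) ∨ I.lo = ⊤) ∧
  ((∃ m : ℕ, I.hi = ((m : ℝ) : EReal)) ∨ I.hi = ⊤)

/-- All intervals of the formula have endpoints in `ℕ ∪ {0,∞}`. -/
def MTL.NatIntervals : MTL → Prop
  | .atom _ => True
  | .tt => True
  | .and φ ψ => φ.NatIntervals ∧ ψ.NatIntervals
  | .not φ => φ.NatIntervals
  | .until I φ ψ => I.NatEnds ∧ φ.NatIntervals ∧ ψ.NatIntervals
  | .since I φ ψ => I.NatEnds ∧ φ.NatIntervals ∧ ψ.NatIntervals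

/-- `MTL[U_I, S_np]` : all since-intervals are non-punctual. -/
def MTL.SinceNP : MTL → Prop
  | .atom _ => True
  | .tt => True
  | .and φ ψ => φ.SinceNP ∧ ψ.SinceNP
  | .not φ => φ.SinceNP
  | .until _ φ ψ => φ.SinceNP ∧ ψ.SinceNP
  | .since I φ ψ => I.NonPunctual ∧ φ.SinceNP ∧ ψ.SinceNP

/-- `MTL[U_np, S_I]` : all until-intervals are non-punctual. -/
def MTL.UntilNP : MTL → Prop
  | .atom _ => True
  | .tt => True
  | .and φ ψ => φ.UntilNP ∧ ψ.UntilNP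
  | .not φ => φ.UntilNP
  | .until I φ ψ => I.NonPunctual ∧ φ.UntilNP ∧ ψ.UntilNP
  | .since _ φ ψ => φ.UntilNP ∧ ψ.UntilNP

/-- Partially punctual MTL: punctual intervals only in until modalities or
only in since modalities. -/
def MTL.IsPMTL (φ : MTL) : Prop := φ.SinceNP ∨ φ.UntilNP

/-- The open interval `(1,2)`. -/
def ioo12 : TInterval :=
  ⟨(((1 : ℤ) : ℝ) : EReal), (((2 : ℤ) : ℝ) : EReal), false, false,
    Or.inr (Or.inr ⟨1, rfl⟩), Or.inr (Or.inr ⟨2, rfl⟩)⟩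

/-- `ψ = ◇[a ∧ x.(◇(b ∧ T−x∈(1,2) ∧ ◇(c ∧ T−x∈(1,2))))]` with `a,b,c` coded
as `0,1,2`. -/
def psiWitness : TPTL :=
  .until .tt (.and (.atom 0)
    (.freeze (.until .tt (.and (.atom 1) (.and (.constr ioo12)
      (.until .tt (.and (.atom 2) (.constr ioo12))))))))


/-- Structural induction on MTL formulas, with a case name for until that is not a keyword. -/
theorem mtl_ind {motive : MTL → Prop} (atom : ∀ a, motive (.atom a)) (tt : motive .tt)
    (and : ∀ φ ψ, motive φ → motive ψ → motive (.and φ ψ))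
    (not : ∀ φ, motive φ → motive (.not φ))
    (untl : ∀ I φ ψ, motive φ → motive ψ → motive (.until I φ ψ))
    (since : ∀ I φ ψ, motive φ → motive ψ → motive (.since I φ ψ)) (φ : MTL) : motive φ :=
  MTL.rec atom tt and not untl since φ

/-! ### Part (a): translation -/

def RP (P : EReal → Prop) (I I' : TInterval) : Prop :=
  (I.hi = I'.lo → P I.hi) ∧ (I.lo = I'.hi → P I.lo)

noncomputable def TInterval.below (I : TInterval) : TInterval :=
  ⟨⊥, I.lo, false, !I.loC, Or.inl rfl, I.lo_int⟩

noncomputable def TInterval.above (I : TInterval) : TInterval :=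
  ⟨I.hi, ⊤, !I.hiC, false, I.hi_int, Or.inr (Or.inl rfl)⟩

theorem neg_int_end {e : EReal}
    (h : e = ⊥ ∨ e = ⊤ ∨ ∃ z : ℤ, e = ((z : ℝ) : EReal)) :
    -e = ⊥ ∨ -e = ⊤ ∨ ∃ z : ℤ, -e = ((z : ℝ) : EReal) := by
  rcases h with h | h | ⟨z, h⟩
  · right; left; simp [h]
  · left; simp [h]
  · right; right; refine ⟨-z, ?_⟩; rw [h]; push_cast; rfl

noncomputable def TInterval.negI (I : TInterval) : TInterval :=
  ⟨-I.hi, -I.lo, I.hiC, I.loC, neg_int_end I.hi_int, neg_int_end I.lo_int⟩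

theorem TInterval.negI_mem (I : TInterval) (t : ℝ) : I.negI.mem t ↔ I.mem (-t) := by
  have h1 : ∀ e : EReal, (-e ≤ (t : EReal) ↔ ((-t : ℝ) : EReal) ≤ e) := by
    intro e
    rw [EReal.coe_neg]; exact EReal.neg_le
  have h2 : ∀ e : EReal, ((t : EReal) ≤ -e ↔ e ≤ ((-t : ℝ) : EReal)) := by
    intro e
    rw [EReal.coe_neg]; exact EReal.le_neg
  have h3 : ∀ e : EReal, (-e < (t : EReal) ↔ ((-t : ℝ) : EReal) < e) := by
    intro e
    rw [← not_le, ← not_le, h2]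
  have h4 : ∀ e : EReal, ((t : EReal) < -e ↔ e < ((-t : ℝ) : EReal)) := by
    intro e
    rw [← not_le, ← not_le, h1]
  unfold TInterval.mem TInterval.negI
  simp only [h1, h2, h3, h4]
  exact and_comm

open Classical in
noncomputable def compl (I : TInterval) : TPTL :=
  .or (if I.lo = ⊥ then .ff else .constr I.below) (if I.hi = ⊤ then .ff else .constr I.above)

theorem compl_sat (ρ : TimedWord) (I : TInterval) (i : ℕ) (ν : ℝ) :
    (compl I).sat ρ i ν ↔ ¬ I.mem (ρ.τ i - ν) := by
  generalize ht : ρ.τ i - ν = t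
  have hL : TPTL.sat ρ (if I.lo = ⊥ then .ff else .constr I.below) i ν ↔
      ¬ (if I.loC then I.lo ≤ (t : EReal) else I.lo < (t : EReal)) := by
    split_ifs with h1 h2 h2
    · simp [TPTL.sat, h1]
    · simp [TPTL.sat, h1]
    · simp [TPTL.sat, TInterval.mem, TInterval.below, ht, h2]
    · simp [TPTL.sat, TInterval.mem, TInterval.below, ht, h2]
  have hU : TPTL.sat ρ (if I.hi = ⊤ then .ff else .constr I.above) i ν ↔
      ¬ (if I.hiC then (t : EReal) ≤ I.hi else (t : EReal) < I.hi) := by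
    split_ifs with h1 h2 h2
    · simp [TPTL.sat, h1]
    · simp [TPTL.sat, h1]
    · simp [TPTL.sat, TInterval.mem, TInterval.above, ht, h2]
    · simp [TPTL.sat, TInterval.mem, TInterval.above, ht, h2]
  unfold compl
  simp only [TPTL.sat]
  rw [hL, hU]
  unfold TInterval.mem
  tauto

theorem compl_free (I : TInterval) : ∀ J ∈ (compl I).freeIntervals,
    (I.lo ≠ ⊥ ∧ J = I.below) ∨ (I.hi ≠ ⊤ ∧ J = I.above) := by
  intro J hJ
  unfold compl at hJ
  simp only [TPTL.freeIntervals, List.mem_append] at hJ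
  rcases hJ with hJ | hJ
  · left
    split_ifs at hJ with h
    · simp [TPTL.freeIntervals] at hJ
    · exact ⟨h, by simpa [TPTL.freeIntervals] using hJ⟩
  · right
    split_ifs at hJ with h
    · simp [TPTL.freeIntervals] at hJ
    · exact ⟨h, by simpa [TPTL.freeIntervals] using hJ⟩

theorem compl_pairs (P : EReal → Prop) (I : TInterval) (hI : I.lo = I.hi → P I.lo) :
    ∀ J ∈ (compl I).freeIntervals, ∀ J' ∈ (compl I).freeIntervals, RP P J J' := by
  intro J hJ J' hJ'
  rcases compl_free I J hJ with ⟨h, rfl⟩ | ⟨h, rfl⟩ <;>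
  rcases compl_free I J' hJ' with ⟨h', rfl⟩ | ⟨h', rfl⟩ <;>
  simp only [RP, TInterval.below, TInterval.above]
  · exact ⟨fun e => absurd e h, fun e => absurd e.symm h⟩
  · exact ⟨hI, fun e => absurd e (by simp)⟩
  · exact ⟨fun e => absurd e (by simp), fun e => e ▸ hI e.symm⟩
  · exact ⟨fun e => absurd e.symm h, fun e => absurd e h⟩

theorem compl_nnf (I : TInterval) : (compl I).IsNNF := by
  unfold compl
  simp only [TPTL.IsNNF]
  constructor <;> split_ifs <;> simp [TPTL.IsNNF]

theorem compl_scoped (R : TInterval → TInterval → Prop) (I : TInterval) :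
    (compl I).ScopedPairs R := by
  unfold compl
  simp only [TPTL.ScopedPairs]
  constructor <;> split_ifs <;> simp [TPTL.ScopedPairs]

noncomputable def tr : Bool → MTL → TPTL
  | true, .atom a => .atom a
  | false, .atom a => .not (.atom a)
  | true, .tt => .tt
  | false, .tt => .ff
  | true, .and φ ψ => .and (tr true φ) (tr true ψ)
  | false, .and φ ψ => .or (tr false φ) (tr false ψ)
  | b, .not φ => tr (!b) φ
  | true, .until I φ ψ => .freeze (.until (tr true φ) (.and (tr true ψ) (.constr I)))
  | false, .until I φ ψ =>
      .freeze (.or (.box (.or (tr false ψ) (compl I)))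
        (.until (.or (tr false ψ) (compl I)) (.and (tr false φ) (.or (tr false ψ) (compl I)))))
  | true, .since I φ ψ => .freeze (.since (tr true φ) (.and (tr true ψ) (.constr I.negI)))
  | false, .since I φ ψ =>
      .freeze (.or (.boxm (.or (tr false ψ) (compl I.negI)))
        (.since (.or (tr false ψ) (compl I.negI))
          (.and (tr false φ) (.or (tr false ψ) (compl I.negI)))))

theorem tr_free (φ : MTL) : ∀ b, (tr b φ).freeIntervals = [] := by
  induction φ using mtl_ind with
  | atom a => intro b; cases b <;> simp [tr, TPTL.freeIntervals]
  | tt => intro b; cases b <;> simp [tr, TPTL.freeIntervals]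
  | and φ ψ h1 h2 => intro b; cases b <;> simp [tr, TPTL.freeIntervals, h1, h2]
  | not φ h => intro b; simp only [tr]; exact h _
  | untl I φ ψ h1 h2 => intro b; cases b <;> simp [tr, TPTL.freeIntervals]
  | since I φ ψ h1 h2 => intro b; cases b <;> simp [tr, TPTL.freeIntervals]

theorem tr_nnf (φ : MTL) : ∀ b, (tr b φ).IsNNF := by
  induction φ using mtl_ind with
  | atom a => intro b; cases b <;> simp [tr, TPTL.IsNNF]
  | tt => intro b; cases b <;> simp [tr, TPTL.IsNNF]
  | and φ ψ h1 h2 => intro b; cases b <;> simp [tr, TPTL.IsNNF, h1, h2]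
  | not φ h => intro b; simp only [tr]; exact h _
  | untl I φ ψ h1 h2 => intro b; cases b <;> simp [tr, TPTL.IsNNF, h1, h2, compl_nnf]
  | since I φ ψ h1 h2 => intro b; cases b <;> simp [tr, TPTL.IsNNF, h1, h2, compl_nnf]

def GoodP (P : EReal → Prop) : MTL → Prop
  | .atom _ => True
  | .tt => True
  | .and φ ψ => GoodP P φ ∧ GoodP P ψ
  | .not φ => GoodP P φ
  | .until I φ ψ => (I.lo = I.hi → P I.lo) ∧ GoodP P φ ∧ GoodP P ψ
  | .since I φ ψ => (I.negI.lo = I.negI.hi → P I.negI.lo) ∧ GoodP P φ ∧ GoodP P ψ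

theorem tr_scoped (P : EReal → Prop) (φ : MTL) (hG : GoodP P φ) :
    ∀ b, (tr b φ).ScopedPairs (RP P) := by
  induction φ using mtl_ind with
  | atom a => intro b; cases b <;> simp [tr, TPTL.ScopedPairs]
  | tt => intro b; cases b <;> simp [tr, TPTL.ScopedPairs]
  | and φ ψ h1 h2 =>
    intro b; cases b <;> simp [tr, TPTL.ScopedPairs, h1 hG.1, h2 hG.2]
  | not φ h => intro b; simp only [tr]; exact h hG _
  | untl I φ ψ h1 h2 =>
    obtain ⟨hI, g1, g2⟩ := hG
    intro b; cases b
    · simp only [tr, TPTL.ScopedPairs, h1 g1, h2 g2, compl_scoped, and_self, and_true,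
        TPTL.freeIntervals, tr_free, List.nil_append, List.mem_append, or_self]
      exact compl_pairs P I hI
    · simp only [tr, TPTL.ScopedPairs, h1 g1, h2 g2, and_self, and_true,
        TPTL.freeIntervals, tr_free, List.nil_append, List.mem_singleton]
      rintro J rfl J' rfl
      exact ⟨fun e => e ▸ hI e.symm, hI⟩
  | since I φ ψ h1 h2 =>
    obtain ⟨hI, g1, g2⟩ := hG
    intro b; cases b
    · simp only [tr, TPTL.ScopedPairs, h1 g1, h2 g2, compl_scoped, and_self, and_true,
        TPTL.freeIntervals, tr_free, List.nil_append, List.mem_append, or_self]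
      exact compl_pairs P _ hI
    · simp only [tr, TPTL.ScopedPairs, h1 g1, h2 g2, and_self, and_true,
        TPTL.freeIntervals, tr_free, List.nil_append, List.mem_singleton]
      rintro J rfl J' rfl
      exact ⟨fun e => e ▸ hI e.symm, hI⟩

theorem not_until_iff (A B : ℕ → Prop) (i n : ℕ) :
    (¬ ∃ j, i < j ∧ j < n ∧ B j ∧ ∀ k, i < k → k < j → A k) ↔
    ((∀ j, i < j → j < n → ¬ B j) ∨
      ∃ j, i < j ∧ j < n ∧ (¬ A j ∧ ¬ B j) ∧ ∀ k, i < k → k < j → ¬ B k) := by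
  classical
  constructor
  · intro h
    by_cases hB : ∃ j, i < j ∧ j < n ∧ B j
    · right
      have hs := Nat.find_spec hB
      have hm : ∀ k, i < k → k < Nat.find hB → ¬ B k := fun k h1 h2 h3 =>
        Nat.find_min hB h2 ⟨h1, by omega, h3⟩
      by_contra hc
      refine h ⟨Nat.find hB, hs.1, hs.2.1, hs.2.2, fun k h1 h2 => ?_⟩
      by_contra hA
      exact hc ⟨k, h1, by omega, ⟨hA, hm k h1 h2⟩, fun l h3 h4 => hm l h3 (by omega)⟩
    · left
      intro j h1 h2 h3
      exact hB ⟨j, h1, h2, h3⟩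
  · rintro (h | ⟨j, h1, h2, ⟨h3, h4⟩, h5⟩) ⟨l, l1, l2, l3, l4⟩
    · exact h l l1 l2 l3
    · rcases lt_trichotomy j l with hjl | rfl | hjl
      · exact h3 (l4 j h1 hjl)
      · exact h4 l3
      · exact h5 l l1 hjl l3

theorem not_since_iff (A B : ℕ → Prop) (i : ℕ) :
    (¬ ∃ j, j < i ∧ B j ∧ ∀ k, j < k → k < i → A k) ↔
    ((∀ j, j < i → ¬ B j) ∨
      ∃ j, j < i ∧ (¬ A j ∧ ¬ B j) ∧ ∀ k, j < k → k < i → ¬ B k) := by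
  classical
  constructor
  · intro h
    by_cases hB : ∃ d, d < i ∧ B (i - 1 - d)
    · right
      have hs := Nat.find_spec hB
      have hm : ∀ k, i - 1 - Nat.find hB < k → k < i → ¬ B k := fun k h1 h2 h3 =>
        Nat.find_min hB (m := i - 1 - k) (by omega)
          ⟨by omega, by rwa [show i - 1 - (i - 1 - k) = k by omega]⟩
      by_contra hc
      refine h ⟨_, ?_, hs.2, fun k h1 h2 => ?_⟩
      · omega
      by_contra hA
      exact hc ⟨k, h2, ⟨hA, hm k h1 h2⟩, fun l h3 h4 => hm l (by omega) h4⟩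
    · left
      intro j h1 h3
      exact hB ⟨i - 1 - j, by omega, by rwa [show i - 1 - (i - 1 - j) = j by omega]⟩
  · rintro (h | ⟨j, h1, ⟨h3, h4⟩, h5⟩) ⟨l, l1, l3, l4⟩
    · exact h l l1 l3
    · rcases lt_trichotomy j l with hjl | rfl | hjl
      · exact h5 l hjl l1 l3
      · exact h4 l3
      · exact h3 (l4 j hjl h1)

theorem tr_sat (ρ : TimedWord) (φ : MTL) : ∀ i ν,
    ((tr true φ).sat ρ i ν ↔ φ.sat ρ i) ∧ ((tr false φ).sat ρ i ν ↔ ¬ φ.sat ρ i) := by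
  induction φ using mtl_ind with
  | atom a => intro i ν; simp [tr, TPTL.sat, MTL.sat]
  | tt => intro i ν; simp [tr, TPTL.sat, MTL.sat]
  | and φ ψ h1 h2 =>
    intro i ν
    simp only [tr, TPTL.sat, MTL.sat, h1, h2]
    tauto
  | not φ h =>
    intro i ν
    simp [tr, MTL.sat, h]
  | untl I φ ψ h1 h2 =>
    intro i ν
    have e : ∀ p q : Prop, (¬ p ∨ ¬ q) ↔ ¬ (p ∧ q) := by intros; tauto
    simp only [tr, TPTL.sat, MTL.sat, h1, h2, compl_sat, e]
    constructor
    · simp only [and_assoc]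
    · rw [← not_until_iff (fun j => φ.sat ρ j)
        (fun j => ψ.sat ρ j ∧ I.mem (ρ.τ j - ρ.τ i)) i ρ.n]
      simp only [and_assoc]
  | since I φ ψ h1 h2 =>
    intro i ν
    have e : ∀ p q : Prop, (¬ p ∨ ¬ q) ↔ ¬ (p ∧ q) := by intros; tauto
    simp only [tr, TPTL.sat, MTL.sat, h1, h2, compl_sat, e, TInterval.negI_mem, neg_sub]
    constructor
    · simp only [and_assoc]
    · rw [← not_since_iff (fun j => φ.sat ρ j)
        (fun j => ψ.sat ρ j ∧ I.mem (ρ.τ i - ρ.τ j)) i]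
      simp only [and_assoc]

theorem natEnds_nonneg {I : TInterval} (h : I.NatEnds) : 0 ≤ I.lo := by
  rcases h.1 with ⟨m, h⟩ | h
  · rw [h]; exact_mod_cast Nat.zero_le m
  · rw [h]; exact le_top

theorem good_neg (φ : MTL) (hN : φ.NatIntervals) (h : φ.SinceNP) :
    GoodP (fun e => 0 ≤ e) φ := by
  induction φ using mtl_ind with
  | atom a => trivial
  | tt => trivial
  | and φ ψ h1 h2 => exact ⟨h1 hN.1 h.1, h2 hN.2 h.2⟩
  | not φ h1 => exact h1 hN h
  | untl I φ ψ h1 h2 =>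
    exact ⟨fun _ => natEnds_nonneg hN.1, h1 hN.2.1 h.1, h2 hN.2.2 h.2⟩
  | since I φ ψ h1 h2 =>
    refine ⟨fun e => ?_, h1 hN.2.1 h.2.1, h2 hN.2.2 h.2.2⟩
    have : I.hi = I.lo := neg_injective e
    exact absurd this h.1.ne'

theorem good_pos (φ : MTL) (hN : φ.NatIntervals) (h : φ.UntilNP) :
    GoodP (fun e => e ≤ 0) φ := by
  induction φ using mtl_ind with
  | atom a => trivial
  | tt => trivial
  | and φ ψ h1 h2 => exact ⟨h1 hN.1 h.1, h2 hN.2 h.2⟩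
  | not φ h1 => exact h1 hN h
  | untl I φ ψ h1 h2 =>
    exact ⟨fun e => absurd e h.1.ne, h1 hN.2.1 h.2.1, h2 hN.2.2 h.2.2⟩
  | since I φ ψ h1 h2 =>
    refine ⟨fun e => ?_, h1 hN.2.1 h.1, h2 hN.2.2 h.2⟩
    have e' : -I.hi = -I.lo := e
    change -I.hi ≤ 0
    rw [e']
    have := natEnds_nonneg hN.1
    rw [EReal.neg_le]; simpa using this

theorem part_a (φ : MTL) (hN : φ.NatIntervals) (hP : φ.IsPMTL) :
    ∃ ψ' : TPTL, ψ'.IsNNF ∧ ψ'.IsPA ∧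
        ∀ ρ : TimedWord, MTL.Models ρ φ ↔ TPTL.Models ρ ψ' := by
  refine ⟨tr true φ, tr_nnf φ true, ?_, fun ρ => ((tr_sat ρ φ 0 0).1).symm⟩
  rcases hP with h | h
  · right; exact tr_scoped _ φ (good_neg φ hN h) true
  · left; exact tr_scoped _ φ (good_pos φ hN h) true

/-! ### Part (b): indistinguishable words -/

theorem lo_iff (b : Bool) (m c : ℕ) (t : ℝ) (h1 : (c : ℝ) < t) (h2 : t < c + 1) :
    (if b then (((m : ℝ) : EReal) ≤ (t : EReal)) else (((m : ℝ) : EReal) < (t : EReal))) ↔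
      m ≤ c := by
  have k1 : m ≤ c → (m : ℝ) < t := fun h => by
    have : (m : ℝ) ≤ c := by exact_mod_cast h
    linarith
  have k2 : (m : ℝ) ≤ t → m ≤ c := fun h => by
    have : (m : ℝ) < (c + 1 : ℕ) := by push_cast; linarith
    have : m < c + 1 := by exact_mod_cast this
    omega
  cases b
  · simp only [Bool.false_eq_true, if_false, EReal.coe_lt_coe_iff]
    exact ⟨fun h => k2 h.le, k1⟩
  · simp only [if_true, EReal.coe_le_coe_iff]
    exact ⟨k2, fun h => (k1 h).le⟩

theorem hi_iff (b : Bool) (m c : ℕ) (t : ℝ) (h1 : (c : ℝ) < t) (h2 : t < c + 1) :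
    (if b then ((t : EReal) ≤ ((m : ℝ) : EReal)) else ((t : EReal) < ((m : ℝ) : EReal))) ↔
      c < m := by
  have := lo_iff (!b) m c t h1 h2
  cases b <;> simp at this ⊢
  · rw [← not_le, this]; omega
  · rw [← not_lt, this]; omega

/-- Membership depends only on the integer part, and is constant for large values. -/
theorem mem_cls (I : TInterval) (h : I.NatEnds) : ∃ M : ℕ, ∀ (c c' : ℕ) (t t' : ℝ),
    ((c : ℝ) < t ∧ t < c + 1) → ((c' : ℝ) < t' ∧ t' < c' + 1) →
    (c = c' ∨ (M ≤ c ∧ M ≤ c')) → I.mem t → I.mem t' := by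
  obtain ⟨hl, hh⟩ := h
  unfold TInterval.mem
  rcases hl with ⟨m, hl⟩ | hl
  · rcases hh with ⟨m', hh⟩ | hh
    · refine ⟨m + m', ?_⟩
      rintro c c' t t' ⟨a1, a2⟩ ⟨b1, b2⟩ hc
      rw [hl, hh, lo_iff _ _ _ _ a1 a2, lo_iff _ _ _ _ b1 b2, hi_iff _ _ _ _ a1 a2,
        hi_iff _ _ _ _ b1 b2]
      omega
    · refine ⟨m, ?_⟩
      rintro c c' t t' ⟨a1, a2⟩ ⟨b1, b2⟩ hc
      rw [hl, hh, lo_iff _ _ _ _ a1 a2, lo_iff _ _ _ _ b1 b2]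
      simp
      omega
  · refine ⟨0, ?_⟩
    rintro c c' t t' _ _ _ ⟨h, _⟩
    rw [hl] at h
    simp at h

/-- Integer part of the time distance in the base word. -/
def cl (x y : ℕ) : ℕ := y / 2 - x / 2 - 1

def lab (x : ℕ) : Set ℕ := if x % 2 = 0 then {0, 2} else {1}

def IsBase (ρ : TimedWord) : Prop :=
  (∀ x, ρ.σ x = lab x) ∧
  ∀ x y, x < y → y < ρ.n → (cl x y : ℝ) < ρ.τ y - ρ.τ x ∧ ρ.τ y - ρ.τ x < cl x y + 1

def cl' (m x y : ℕ) : ℕ := if x = m ∧ y = m + 3 then 1 else cl x y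

def IsMod (m : ℕ) (ρ : TimedWord) : Prop :=
  (∀ x, ρ.σ x = lab x) ∧
  ∀ x y, x < y → y < ρ.n → (cl' m x y : ℝ) < ρ.τ y - ρ.τ x ∧ ρ.τ y - ρ.τ x < cl' m x y + 1

theorem shift_lemma (φ : MTL) (hN : φ.NatIntervals) :
    ∃ D, ∀ ρ : TimedWord, IsBase ρ → ∀ x, D ≤ x → x + 2 + D < ρ.n →
      (φ.sat ρ x ↔ φ.sat ρ (x + 2)) := by
  induction φ using mtl_ind with
  | atom a =>
    refine ⟨0, fun ρ hρ x _ _ => ?_⟩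
    simp [MTL.sat, hρ.1, lab]
  | tt => exact ⟨0, fun ρ hρ x _ _ => by simp [MTL.sat]⟩
  | and φ ψ h1 h2 =>
    obtain ⟨D1, h1⟩ := h1 hN.1
    obtain ⟨D2, h2⟩ := h2 hN.2
    refine ⟨D1 + D2, fun ρ hρ x _ _ => ?_⟩
    simp only [MTL.sat]
    rw [h1 ρ hρ x (by omega) (by omega), h2 ρ hρ x (by omega) (by omega)]
  | not φ h1 =>
    obtain ⟨D1, h1⟩ := h1 hN
    refine ⟨D1, fun ρ hρ x _ _ => ?_⟩
    simp only [MTL.sat]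
    rw [h1 ρ hρ x (by omega) (by omega)]
  | untl I φ ψ h1 h2 =>
    obtain ⟨D1, h1⟩ := h1 hN.2.1
    obtain ⟨D2, h2⟩ := h2 hN.2.2
    obtain ⟨M, hM⟩ := mem_cls I hN.1
    refine ⟨D1 + D2 + 2 * M + 20, fun ρ hρ x hx1 hx2 => ?_⟩
    have h1 := h1 ρ hρ
    have h2 := h2 ρ hρ
    have hc := hρ.2
    simp only [MTL.sat]
    constructor
    · rintro ⟨y, y1, y2, y3, y4, y5⟩
      by_cases hy : y + 2 + (D1 + D2) < ρ.n
      · refine ⟨y + 2, by omega, by omega, (h2 y (by omega) (by omega)).1 y3, ?_, ?_⟩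
        · exact hM _ _ _ _ (hc x y (by omega) (by omega)) (hc (x+2) (y+2) (by omega) (by omega))
            (Or.inl (by unfold cl; omega)) y4
        · intro k k1 k2
          have := (h1 (k - 2) (by omega) (by omega)).1 (y5 (k - 2) (by omega) (by omega))
          rwa [show k - 2 + 2 = k by omega] at this
      · refine ⟨y, by omega, by omega, y3, ?_, ?_⟩
        · exact hM _ _ _ _ (hc x y (by omega) (by omega)) (hc (x+2) y (by omega) (by omega))
            (Or.inr (by unfold cl; omega)) y4
        · intro k k1 k2
          exact y5 k (by omega) (by omega)
    · rintro ⟨y, y1, y2, y3, y4, y5⟩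
      by_cases hy : y + (D1 + D2) < ρ.n
      · refine ⟨y - 2, by omega, by omega, (h2 (y - 2) (by omega) (by omega)).2 ?_, ?_, ?_⟩
        · rwa [show y - 2 + 2 = y by omega]
        · exact hM _ _ _ _ (hc (x+2) y (by omega) (by omega)) (hc x (y-2) (by omega) (by omega))
            (Or.inl (by unfold cl; omega)) y4
        · intro k k1 k2
          exact (h1 k (by omega) (by omega)).2 (y5 (k + 2) (by omega) (by omega))
      · refine ⟨y, by omega, by omega, y3, ?_, ?_⟩
        · exact hM _ _ _ _ (hc (x+2) y (by omega) (by omega)) (hc x y (by omega) (by omega))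
            (Or.inr (by unfold cl; omega)) y4
        · intro k k1 k2
          by_cases hk : k ≤ x + 2
          · exact (h1 k (by omega) (by omega)).2 (y5 (k + 2) (by omega) (by omega))
          · exact y5 k (by omega) (by omega)
  | since I φ ψ h1 h2 =>
    obtain ⟨D1, h1⟩ := h1 hN.2.1
    obtain ⟨D2, h2⟩ := h2 hN.2.2
    obtain ⟨M, hM⟩ := mem_cls I hN.1
    refine ⟨D1 + D2 + 2 * M + 20, fun ρ hρ x hx1 hx2 => ?_⟩
    have h1 := h1 ρ hρ
    have h2 := h2 ρ hρ
    have hc := hρ.2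
    simp only [MTL.sat]
    constructor
    · rintro ⟨y, y1, y3, y4, y5⟩
      by_cases hy : D1 + D2 ≤ y
      · refine ⟨y + 2, by omega, (h2 y (by omega) (by omega)).1 y3, ?_, ?_⟩
        · exact hM _ _ _ _ (hc y x (by omega) (by omega)) (hc (y+2) (x+2) (by omega) (by omega))
            (Or.inl (by unfold cl; omega)) y4
        · intro k k1 k2
          have := (h1 (k - 2) (by omega) (by omega)).1 (y5 (k - 2) (by omega) (by omega))
          rwa [show k - 2 + 2 = k by omega] at this
      · refine ⟨y, by omega, y3, ?_, ?_⟩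
        · exact hM _ _ _ _ (hc y x (by omega) (by omega)) (hc y (x+2) (by omega) (by omega))
            (Or.inr (by unfold cl; omega)) y4
        · intro k k1 k2
          by_cases hk : x ≤ k
          · have := (h1 (k - 2) (by omega) (by omega)).1 (y5 (k - 2) (by omega) (by omega))
            rwa [show k - 2 + 2 = k by omega] at this
          · exact y5 k (by omega) (by omega)
    · rintro ⟨y, y1, y3, y4, y5⟩
      by_cases hy : D1 + D2 + 2 ≤ y
      · refine ⟨y - 2, by omega, (h2 (y - 2) (by omega) (by omega)).2 ?_, ?_, ?_⟩
        · rwa [show y - 2 + 2 = y by omega]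
        · exact hM _ _ _ _ (hc y (x+2) (by omega) (by omega)) (hc (y-2) x (by omega) (by omega))
            (Or.inl (by unfold cl; omega)) y4
        · intro k k1 k2
          exact (h1 k (by omega) (by omega)).2 (y5 (k + 2) (by omega) (by omega))
      · refine ⟨y, by omega, y3, ?_, ?_⟩
        · exact hM _ _ _ _ (hc y (x+2) (by omega) (by omega)) (hc y x (by omega) (by omega))
            (Or.inr (by unfold cl; omega)) y4
        · intro k k1 k2
          exact y5 k (by omega) (by omega)

theorem mod_lemma (φ : MTL) (hN : φ.NatIntervals) :
    ∃ D, ∀ (m : ℕ) (ρ ρ' : TimedWord), IsBase ρ → IsMod m ρ' → ρ'.n = ρ.n → m % 2 = 0 →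
      D ≤ m → m + D < ρ.n → ∀ x, x < ρ.n → (φ.sat ρ x ↔ φ.sat ρ' x) := by
  induction φ using mtl_ind with
  | atom a =>
    refine ⟨0, fun m ρ ρ' hρ hρ' hn hm _ _ x _ => ?_⟩
    simp [MTL.sat, hρ.1, hρ'.1]
  | tt => exact ⟨0, fun m ρ ρ' hρ hρ' hn hm _ _ x _ => by simp [MTL.sat]⟩
  | and φ ψ h1 h2 =>
    obtain ⟨D1, h1⟩ := h1 hN.1
    obtain ⟨D2, h2⟩ := h2 hN.2
    refine ⟨D1 + D2, fun m ρ ρ' hρ hρ' hn hm _ _ x hx => ?_⟩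
    simp only [MTL.sat]
    rw [h1 m ρ ρ' hρ hρ' hn hm (by omega) (by omega) x hx,
      h2 m ρ ρ' hρ hρ' hn hm (by omega) (by omega) x hx]
  | not φ h1 =>
    obtain ⟨D1, h1⟩ := h1 hN
    refine ⟨D1, fun m ρ ρ' hρ hρ' hn hm _ _ x hx => ?_⟩
    simp only [MTL.sat]
    rw [h1 m ρ ρ' hρ hρ' hn hm (by omega) (by omega) x hx]
  | untl I φ ψ h1 h2 =>
    obtain ⟨D1, h1⟩ := h1 hN.2.1
    obtain ⟨D2, h2⟩ := h2 hN.2.2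
    obtain ⟨D3, s1⟩ := shift_lemma φ hN.2.1
    obtain ⟨D4, s2⟩ := shift_lemma ψ hN.2.2
    obtain ⟨M, hM⟩ := mem_cls I hN.1
    refine ⟨D1 + D2 + D3 + D4 + 20, fun m ρ ρ' hρ hρ' hn hm hD1 hD2 x hx => ?_⟩
    have h1 := h1 m ρ ρ' hρ hρ' hn hm (by omega) (by omega)
    have h2 := h2 m ρ ρ' hρ hρ' hn hm (by omega) (by omega)
    have s1 := s1 ρ hρ
    have s2 := s2 ρ hρ
    have hc := hρ.2
    have hc' := hρ'.2
    rw [hn] at hc'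
    simp only [MTL.sat, hn]
    constructor
    · rintro ⟨y, y1, y2, y3, y4, y5⟩
      by_cases hy : x = m ∧ y = m + 3
      · obtain ⟨rfl, rfl⟩ := hy
        refine ⟨x + 1, by omega, by omega, ?_, ?_, ?_⟩
        · rw [← h2 _ (by omega)]
          exact (s2 (x + 1) (by omega) (by omega)).2 y3
        · exact hM _ _ _ _ (hc x (x+3) (by omega) (by omega))
            (hc' x (x+1) (by omega) (by omega))
            (Or.inl (by unfold cl' cl; split_ifs <;> omega)) y4
        · intro k k1 k2
          omega
      · refine ⟨y, y1, y2, (h2 y y2).1 y3, ?_, fun k k1 k2 =>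
          (h1 k (by omega)).1 (y5 k k1 k2)⟩
        exact hM _ _ _ _ (hc x y (by omega) (by omega))
            (hc' x y (by omega) (by omega))
            (Or.inl (by unfold cl'; rw [if_neg hy])) y4
    · rintro ⟨y, y1, y2, y3, y4, y5⟩
      by_cases hy : x = m ∧ y = m + 3
      · obtain ⟨rfl, rfl⟩ := hy
        have q1 := (h1 (x + 1) (by omega)).2 (y5 (x + 1) (by omega) (by omega))
        have q2 := (h1 (x + 2) (by omega)).2 (y5 (x + 2) (by omega) (by omega))
        have q3 := (s1 (x + 1) (by omega) (by omega)).1 q1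
        have q4 := (s1 (x + 2) (by omega) (by omega)).1 q2
        refine ⟨x + 5, by omega, by omega, ?_, ?_, ?_⟩
        · exact (s2 (x + 3) (by omega) (by omega)).1 ((h2 _ (by omega)).2 y3)
        · exact hM _ _ _ _ (hc' x (x+3) (by omega) (by omega))
            (hc x (x+5) (by omega) (by omega))
            (Or.inl (by unfold cl' cl; split_ifs <;> omega)) y4
        · intro k k1 k2
          obtain rfl | rfl | rfl | rfl : k = x + 1 ∨ k = x + 2 ∨ k = x + 1 + 2 ∨ k = x + 2 + 2 := by
            omega
          all_goals assumption
      · refine ⟨y, y1, y2, (h2 y y2).2 y3, ?_, fun k k1 k2 =>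
          (h1 k (by omega)).2 (y5 k k1 k2)⟩
        exact hM _ _ _ _ (hc' x y (by omega) (by omega))
            (hc x y (by omega) (by omega))
            (Or.inl (by unfold cl'; rw [if_neg hy])) y4
  | since I φ ψ h1 h2 =>
    obtain ⟨D1, h1⟩ := h1 hN.2.1
    obtain ⟨D2, h2⟩ := h2 hN.2.2
    obtain ⟨D3, s1⟩ := shift_lemma φ hN.2.1
    obtain ⟨D4, s2⟩ := shift_lemma ψ hN.2.2
    obtain ⟨M, hM⟩ := mem_cls I hN.1
    refine ⟨D1 + D2 + D3 + D4 + 20, fun m ρ ρ' hρ hρ' hn hm hD1 hD2 x hx => ?_⟩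
    have h1 := h1 m ρ ρ' hρ hρ' hn hm (by omega) (by omega)
    have h2 := h2 m ρ ρ' hρ hρ' hn hm (by omega) (by omega)
    have s1 := s1 ρ hρ
    have s2 := s2 ρ hρ
    have hc := hρ.2
    have hc' := hρ'.2
    rw [hn] at hc'
    simp only [MTL.sat]
    constructor
    · rintro ⟨y, y1, y3, y4, y5⟩
      by_cases hy : y = m ∧ x = m + 3
      · obtain ⟨rfl, rfl⟩ := hy
        refine ⟨y + 2, by omega, ?_, ?_, ?_⟩
        · rw [← h2 _ (by omega)]
          exact (s2 y (by omega) (by omega)).1 y3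
        · exact hM _ _ _ _ (hc y (y+3) (by omega) (by omega))
            (hc' (y+2) (y+3) (by omega) (by omega))
            (Or.inl (by unfold cl' cl; split_ifs <;> omega)) y4
        · intro k k1 k2
          omega
      · refine ⟨y, y1, (h2 y (by omega)).1 y3, ?_, fun k k1 k2 =>
          (h1 k (by omega)).1 (y5 k k1 k2)⟩
        exact hM _ _ _ _ (hc y x (by omega) (by omega))
            (hc' y x (by omega) (by omega))
            (Or.inl (by unfold cl'; rw [if_neg hy])) y4
    · rintro ⟨y, y1, y3, y4, y5⟩
      by_cases hy : y = m ∧ x = m + 3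
      · obtain ⟨rfl, rfl⟩ := hy
        obtain ⟨z, rfl⟩ : ∃ z, y = z + 2 := ⟨y - 2, by omega⟩
        have q1 := (h1 (z + 3) (by omega)).2 (y5 (z + 3) (by omega) (by omega))
        have q2 := (h1 (z + 4) (by omega)).2 (y5 (z + 4) (by omega) (by omega))
        have q3 := (s1 (z + 1) (by omega) (by omega)).2 q1
        have q4 := (s1 (z + 2) (by omega) (by omega)).2 q2
        refine ⟨z, by omega, ?_, ?_, ?_⟩
        · exact (s2 z (by omega) (by omega)).2 ((h2 _ (by omega)).2 y3)
        · exact hM _ _ _ _ (hc' (z+2) (z+2+3) (by omega) (by omega))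
            (hc z (z+2+3) (by omega) (by omega))
            (Or.inl (by unfold cl' cl; split_ifs <;> omega)) y4
        · intro k k1 k2
          obtain rfl | rfl | rfl | rfl : k = z + 1 ∨ k = z + 2 ∨ k = z + 3 ∨ k = z + 4 := by
            omega
          all_goals assumption
      · refine ⟨y, y1, (h2 y (by omega)).2 y3, ?_, fun k k1 k2 =>
          (h1 k (by omega)).2 (y5 k k1 k2)⟩
        exact hM _ _ _ _ (hc' y x (by omega) (by omega))
            (hc y x (by omega) (by omega))
            (Or.inl (by unfold cl'; rw [if_neg hy])) y4

/-- Scale: the words have `2 * N` positions and the small time step is `2 / (8 * N + 8)`. -/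
noncomputable def uu (N : ℕ) : ℝ := 1 / (8 * N + 8)

noncomputable def tauB (N : ℕ) (x : ℕ) : ℝ :=
  ((x / 2 : ℕ) : ℝ) * (1 - 4 * uu N) + 2 * uu N * ((x % 2 : ℕ) : ℝ)

noncomputable def tauM (N m : ℕ) (x : ℕ) : ℝ :=
  tauB N x - if x = m then 3 * uu N else 0

theorem uu_pos (N : ℕ) : 0 < uu N := by unfold uu; positivity

theorem uu_eq (N : ℕ) : uu N * (8 * N + 8) = 1 := by
  unfold uu; field_simp

/-- Time differences in the base word. -/
theorem tauB_diff (N x y : ℕ) (hxy : x < y) (hy : y < 2 * N) :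
    (y / 2 = x / 2 ∧ tauB N y - tauB N x = 2 * uu N) ∨
    (x / 2 < y / 2 ∧ ((cl x y : ℕ) : ℝ) + 1 - tauB N y + tauB N x =
      uu N * ((4 * (y / 2 - x / 2) + 2 * (x % 2) - 2 * (y % 2) : ℕ) : ℝ)) := by
  rcases Nat.lt_or_ge (x / 2) (y / 2) with h | h
  · right
    refine ⟨h, ?_⟩
    obtain ⟨d, hd⟩ : ∃ d, y / 2 = x / 2 + 1 + d := ⟨y / 2 - x / 2 - 1, by omega⟩
    have e1 : cl x y = d := by unfold cl; omega
    rw [Nat.cast_sub (by omega), e1]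
    unfold tauB
    rw [hd, show x / 2 + 1 + d - x / 2 = d + 1 by omega]
    push_cast
    ring
  · left
    have h1 : y / 2 = x / 2 := by omega
    refine ⟨h1, ?_⟩
    unfold tauB
    rw [h1, show y % 2 = 1 by omega, show x % 2 = 0 by omega]
    push_cast
    ring

theorem tauM_cls (N m x y : ℕ) (hm : m % 2 = 0) (hxy : x < y) (hy : y < 2 * N) :
    (cl' m x y : ℝ) < tauM N m y - tauM N m x ∧
      tauM N m y - tauM N m x < cl' m x y + 1 := by
  have hu := uu_pos N
  have hu1 := uu_eq N
  have hN : (1 : ℝ) ≤ N := by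
    have : 1 ≤ N := by omega
    exact_mod_cast this
  have hu2 : uu N * 16 ≤ 1 := by nlinarith
  unfold tauM
  rcases tauB_diff N x y hxy hy with ⟨h1, h2⟩ | ⟨h1, h2⟩
  · have hc : cl' m x y = 0 := by unfold cl' cl; split_ifs <;> omega
    have : y ≠ m := by omega
    rw [hc, if_neg this]
    push_cast
    split_ifs <;> constructor <;> linarith
  · generalize hE : 4 * (y / 2 - x / 2) + 2 * (x % 2) - 2 * (y % 2) = E at h2
    have hE1 : E + 4 ≤ 8 * N := by omega
    have hE1' : (E : ℝ) + 4 ≤ 8 * N := by exact_mod_cast hE1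
    have hE2 : 2 ≤ E := by omega
    have hE2' : (2 : ℝ) ≤ E := by exact_mod_cast hE2
    by_cases hs : x = m ∧ y = m + 3
    · have hE3 : E = 2 := by omega
      have hc : cl x y = 0 := by unfold cl; omega
      have hc' : cl' m x y = 1 := by unfold cl'; rw [if_pos hs]
      rw [hE3, hc] at h2
      rw [hc', if_pos hs.1, if_neg (by omega)]
      push_cast at h2 ⊢
      constructor <;> linarith
    · have hc' : cl' m x y = cl x y := by unfold cl'; rw [if_neg hs]
      rw [hc']
      have b1 : uu N * E + 3 * uu N < 1 := by nlinarith
      have b2 : 0 < uu N * E := by positivity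
      by_cases hx : x = m
      · have hE4 : 4 ≤ E := by omega
        have hE4' : (4 : ℝ) ≤ E := by exact_mod_cast hE4
        have b3 : uu N * 4 ≤ uu N * E := by gcongr
        rw [if_pos hx, if_neg (by omega)]
        constructor <;> linarith
      · rw [if_neg hx]
        split_ifs <;> constructor <;> linarith

theorem tauM_mono (N m : ℕ) (hm : m % 2 = 0) (i j : ℕ) (hij : i ≤ j) (hj : j < 2 * N) :
    tauM N m i ≤ tauM N m j := by
  rcases hij.eq_or_lt with rfl | h
  · exact le_rfl
  · have := (tauM_cls N m i j hm h hj).1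
    have h0 : (0 : ℝ) ≤ cl' m i j := Nat.cast_nonneg _
    linarith

theorem lab_nonempty (x : ℕ) : (lab x).Nonempty := by
  unfold lab; split_ifs <;> simp

theorem tauM_zero (N m : ℕ) (hm : m ≠ 0) : tauM N m 0 = 0 := by
  simp [tauM, tauB, hm.symm]

/-- The word with a perturbation at (even) position `m`. -/
noncomputable def wordM (N m : ℕ) (hN : 0 < N) (hm : m % 2 = 0) (hm0 : m ≠ 0) : TimedWord where
  n := 2 * N
  npos := by omega
  σ := lab
  τ := tauM N m
  sigma_nonempty := fun i _ => lab_nonempty i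
  tau_nonneg := fun i hi => by
    have := tauM_mono N m hm 0 i (by omega) hi
    rwa [tauM_zero N m hm0] at this
  tau_zero := tauM_zero N m hm0
  tau_mono := tauM_mono N m hm

theorem wordM_isMod (N m : ℕ) (hN : 0 < N) (hm : m % 2 = 0) (hm0 : m ≠ 0) :
    IsMod m (wordM N m hN hm hm0) :=
  ⟨fun _ => rfl, fun x y h1 h2 => tauM_cls N m x y hm h1 h2⟩

/-- Perturbing a position beyond the end gives the base word. -/
theorem wordM_isBase (N : ℕ) (hN : 0 < N) (hm : (2 * N) % 2 = 0) (hm0 : 2 * N ≠ 0) :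
    IsBase (wordM N (2 * N) hN hm hm0) := by
  refine ⟨fun _ => rfl, fun x y h1 h2 => ?_⟩
  have h2' : y < 2 * N := h2
  have := tauM_cls N (2 * N) x y hm h1 h2
  rwa [show cl' (2 * N) x y = cl x y by unfold cl'; rw [if_neg (by omega)]] at this

theorem ioo12_mem (t : ℝ) : ioo12.mem t ↔ 1 < t ∧ t < 2 := by
  have e1 : (((1 : ℤ) : ℝ) : EReal) < (t : EReal) ↔ 1 < t := by
    rw [EReal.coe_lt_coe_iff]; norm_num
  have e2 : (t : EReal) < (((2 : ℤ) : ℝ) : EReal) ↔ t < 2 := by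
    rw [EReal.coe_lt_coe_iff]; norm_num
  simp only [TInterval.mem, ioo12, Bool.false_eq_true, if_false]
  rw [e1, e2]

theorem psi_sat (ρ : TimedWord) (hσ : ∀ x, ρ.σ x = lab x) :
    TPTL.Models ρ psiWitness ↔ ∃ x y z, 0 < x ∧ x < y ∧ y < z ∧ z < ρ.n ∧
      x % 2 = 0 ∧ y % 2 = 1 ∧ z % 2 = 0 ∧ (1 < ρ.τ y - ρ.τ x ∧ ρ.τ y - ρ.τ x < 2) ∧
      (1 < ρ.τ z - ρ.τ x ∧ ρ.τ z - ρ.τ x < 2) := by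
  have l0 : ∀ x, 0 ∈ lab x ↔ x % 2 = 0 := by
    intro x; unfold lab; split_ifs with h <;> simp [h]
  have l1 : ∀ x, 1 ∈ lab x ↔ x % 2 = 1 := by
    intro x; unfold lab; split_ifs with h <;> simp [h] <;> omega
  have l2 : ∀ x, 2 ∈ lab x ↔ x % 2 = 0 := by
    intro x; unfold lab; split_ifs with h <;> simp [h]
  simp only [TPTL.Models, psiWitness, TPTL.sat, hσ, l0, l1, l2, ioo12_mem, implies_true, and_true]
  constructor
  · rintro ⟨x, x1, x2, x3, y, y1, y2, y3, y4, z, z1, z2, z3, z4⟩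
    exact ⟨x, y, z, x1, y1, z1, z2, x3, y3, z3, y4, z4⟩
  · rintro ⟨x, y, z, x1, y1, z1, z2, x3, y3, z3, y4, z4⟩
    exact ⟨x, x1, by omega, x3, y, y1, by omega, y3, y4, z, z1, z2, z3, z4⟩

theorem base_not_psi (ρ : TimedWord) (h : IsBase ρ) : ¬ TPTL.Models ρ psiWitness := by
  rw [psi_sat ρ h.1]
  rintro ⟨x, y, z, x1, y1, z1, z2, x3, y3, z3, y4, z4⟩
  have key : ∀ w, x < w → w < ρ.n → 1 < ρ.τ w - ρ.τ x → ρ.τ w - ρ.τ x < 2 → cl x w = 1 := by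
    intro w w1 w2 w3 w4
    obtain ⟨a, b⟩ := h.2 x w w1 w2
    have c1 : (cl x w : ℝ) < (2 : ℕ) := by push_cast; linarith
    have c2 : ((0 : ℕ) : ℝ) < cl x w := by push_cast; linarith
    have c1 : cl x w < 2 := by exact_mod_cast c1
    have c2 : 0 < cl x w := by exact_mod_cast c2
    omega
  have k1 := key y y1 (by omega) y4.1 y4.2
  have k2 := key z (by omega) z2 z4.1 z4.2
  unfold cl at k1 k2
  omega

theorem mod_psi (m : ℕ) (ρ : TimedWord) (h : IsMod m ρ) (hm : m % 2 = 0) (hm0 : 0 < m)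
    (hn : m + 4 < ρ.n) : TPTL.Models ρ psiWitness := by
  rw [psi_sat ρ h.1]
  have c1 : cl' m m (m + 3) = 1 := by unfold cl'; simp
  have c2 : cl' m m (m + 4) = 1 := by unfold cl' cl; rw [if_neg (by omega)]; omega
  have k1 := h.2 m (m + 3) (by omega) (by omega)
  have k2 := h.2 m (m + 4) (by omega) (by omega)
  rw [c1] at k1
  rw [c2] at k2
  push_cast at k1 k2
  refine ⟨m, m + 3, m + 4, hm0, by omega, by omega, hn, hm, by omega, by omega, ?_, ?_⟩
  · exact ⟨k1.1, by linarith [k1.2]⟩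
  · exact ⟨k2.1, by linarith [k2.2]⟩

theorem part_b (φ : MTL) (hN : φ.NatIntervals) :
    ¬ (∀ ρ : TimedWord, TPTL.Models ρ psiWitness ↔ MTL.Models ρ φ) := by
  intro H
  obtain ⟨D, hD⟩ := mod_lemma φ hN
  have hB := wordM_isBase (2 * D + 10) (by omega) (by omega) (by omega)
  have hM := wordM_isMod (2 * D + 10) (2 * D + 2) (by omega) (by omega) (by omega)
  have key := hD (2 * D + 2) _ _ hB hM rfl (by omega) (by omega)
    (by change 2 * D + 2 + D < 2 * (2 * D + 10); omega) 0
    (by change 0 < 2 * (2 * D + 10); omega)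
  apply base_not_psi _ hB
  rw [H]
  apply key.2
  apply (H _).1
  exact mod_psi _ _ hM (by omega) (by omega)
    (by change 2 * D + 2 + 4 < 2 * (2 * D + 10); omega)

theorem psi_nnf : psiWitness.IsNNF := by
  simp [psiWitness, TPTL.IsNNF]

theorem psi_pa : psiWitness.IsPA := by
  left
  have h : ioo12.hi ≠ ioo12.lo := by
    simp only [ioo12]
    intro h
    have := EReal.coe_injective h
    norm_num at this
  simp only [TPTL.IsNAp, psiWitness, TPTL.ScopedPairs, TPTL.freeIntervals, and_true, true_and,
    List.nil_append, List.append_nil, List.singleton_append, List.mem_cons, List.not_mem_nil,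
    or_false, or_self]
  rintro I rfl I' rfl
  exact ⟨fun e => absurd e h, fun e => absurd e.symm h⟩

/-- PA-1-TPTL is strictly more expressive than PMTL:
(a) every PMTL formula has a language-equivalent PA-1-TPTL formula, and
(b) the PA-1-TPTL formula `ψ = ◇[a ∧ x.(◇(b ∧ T−x∈(1,2) ∧ ◇(c ∧ T−x∈(1,2))))]`
is not language-equivalent to any `MTL[U_I,S_I]` formula. -/
theorem pa_tptl_strictly_more_expressive_than_pmtl :
    (∀ φ : MTL, φ.NatIntervals → φ.IsPMTL →
      ∃ ψ' : TPTL, ψ'.IsNNF ∧ ψ'.IsPA ∧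
        ∀ ρ : TimedWord, MTL.Models ρ φ ↔ TPTL.Models ρ ψ') ∧
    (psiWitness.IsNNF ∧ psiWitness.IsPA ∧
      ∀ φ : MTL, φ.NatIntervals →
        ¬ (∀ ρ : TimedWord, TPTL.Models ρ psiWitness ↔ MTL.Models ρ φ)) := by
  exact ⟨part_a, psi_nnf, psi_pa, part_b⟩

end Paper
end

section
/- Partially adjacent 1-TPTL is strictly more expressive than non-adjacent 1-TPTL: every NA-1-TPTL formula is a PA-1-TPTL formula, and there exists a PA-1-TPTL formula that is not language-equivalent to any NA-1-TPTL formula (since PA-1-TPTL can express punctual timing constraints in one direction while NA-1-TPTL cannot express any nonzero punctual constraint). -/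
namespace Paper

/-! ### Part one: monotonicity of scoped pairs -/

theorem ScopedPairs.mono {R S : TInterval → TInterval → Prop} (h : ∀ I I', R I I' → S I I') :
    ∀ φ : TPTL, φ.ScopedPairs R → φ.ScopedPairs S := by
  intro φ
  induction φ with
  | freeze φ ih =>
    intro hφ
    exact ⟨fun I hI I' hI' => h _ _ (hφ.1 I hI I' hI'), ih hφ.2⟩
  | and φ ψ ih1 ih2 => exact fun hφ => ⟨ih1 hφ.1, ih2 hφ.2⟩
  | or φ ψ ih1 ih2 => exact fun hφ => ⟨ih1 hφ.1, ih2 hφ.2⟩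
  | since φ ψ ih1 ih2 => exact fun hφ => ⟨ih1 hφ.1, ih2 hφ.2⟩
  | not φ ih => exact fun hφ => ih hφ
  | box φ ih => exact fun hφ => ih hφ
  | boxm φ ih => exact fun hφ => ih hφ
  | atom _ => intro _; trivial
  | tt => intro _; trivial
  | ff => intro _; trivial
  | constr _ => intro _; trivial
  | _ φ ψ ih1 ih2 => exact fun hφ => ⟨ih1 hφ.1, ih2 hφ.2⟩

/-! ### Ehrenfeucht–Fraïssé machinery on integer points -/

/-- Two integers agree up to threshold `T`. -/
def Close (T x y : ℤ) : Prop := x = y ∨ (T ≤ x ∧ T ≤ y) ∨ (x ≤ -T ∧ y ≤ -T)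

/-- A list of pairs of points is a partial isomorphism with distances up to threshold `T`. -/
def PIso (T : ℤ) (S : List (ℤ × ℤ)) : Prop :=
  ∀ p ∈ S, ∀ q ∈ S, Close T (p.1 - q.1) (p.2 - q.2)

theorem PIso.sub {T : ℤ} {S S' : List (ℤ × ℤ)} (h : PIso T S) (hs : S' ⊆ S) : PIso T S' :=
  fun p hp q hq => h p (hs hp) q (hs hq)

theorem PIso.weaken {T T' : ℤ} {S : List (ℤ × ℤ)} (h : PIso T S) (hT : T' ≤ T) : PIso T' S := by
  intro p hp q hq
  have := h p hp q hq
  unfold Close at *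
  omega

theorem PIso.swap {T : ℤ} {S : List (ℤ × ℤ)} (h : PIso T S) : PIso T (S.map Prod.swap) := by
  intro p hp q hq
  rw [List.mem_map] at hp hq
  obtain ⟨p, hp, rfl⟩ := hp
  obtain ⟨q, hq, rfl⟩ := hq
  have := h p hp q hq
  unfold Close at *
  simp only [Prod.fst_swap, Prod.snd_swap]
  omega

theorem PIso.cons {T : ℤ} {S : List (ℤ × ℤ)} (h : PIso T S) (x y : ℤ)
    (hxy : ∀ p ∈ S, Close T (x - p.1) (y - p.2)) : PIso T ((x, y) :: S) := by
  intro p hp q hq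
  rw [List.mem_cons] at hp hq
  rcases hp with rfl | hp <;> rcases hq with rfl | hq
  · left; simp
  · exact hxy q hq
  · have := hxy p hp
    unfold Close at *
    dsimp only at *
    omega
  · exact h p hp q hq

theorem PIso.ext {T : ℤ} (hT : 0 < T) {S : List (ℤ × ℤ)} (h : PIso (2 * T) S) (x : ℤ)
    (p₀ : ℤ × ℤ) (hp₀ : p₀ ∈ S) (hx : p₀.1 < x) : ∃ y, PIso T ((x, y) :: S) := by
  by_cases hc : ∃ p ∈ S, -T < x - p.1 ∧ x - p.1 < T
  · obtain ⟨p, hp, h1, h2⟩ := hc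
    refine ⟨p.2 + (x - p.1), (h.weaken (by omega)).cons _ _ ?_⟩
    intro q hq
    have := h p hp q hq
    unfold Close at *
    omega
  · push Not at hc
    classical
    obtain ⟨m, hm, hmax⟩ := Finset.exists_max_image (S.toFinset.filter (fun p => p.1 < x))
      (fun p => p.1) ⟨p₀, by simp [hp₀, hx]⟩
    simp only [Finset.mem_filter, List.mem_toFinset] at hm hmax
    refine ⟨m.2 + T, (h.weaken (by omega)).cons _ _ ?_⟩
    intro q hq
    have h1 := h m hm.1 q hq
    have h2 := hc q hq
    have h3 := hc m hm.1
    have h4 := hmax q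
    have h5 : q.1 < x → q.1 ≤ m.1 := fun hh => h4 ⟨hq, hh⟩
    unfold Close at *
    omega

theorem PIso.ext' {T : ℤ} (hT : 0 < T) {S : List (ℤ × ℤ)} (h : PIso (2 * T) S) (y : ℤ)
    (p₀ : ℤ × ℤ) (hp₀ : p₀ ∈ S) (hy : p₀.2 < y) : ∃ x, PIso T ((x, y) :: S) := by
  obtain ⟨x, hx⟩ := PIso.ext hT h.swap y p₀.swap (List.mem_map_of_mem hp₀) hy
  refine ⟨x, ?_⟩
  have := hx.swap
  simpa [Function.comp_def] using this

/-! ### The words -/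

/-- Numerators (over `8 * K`) of the time stamps. -/
def num (K : ℕ) (s : ℤ) (j : ℕ) : ℤ :=
  4 * (j : ℤ) + (if j < 2 * K then 0 else if j = 3 * K then s else 1)

/-- The word with `2K` points in `[0,1)` and `2K` points in `(1,2)`. -/
noncomputable def wd (K : ℕ) (hK : 0 < K) (s : ℤ) (h1 : -1 ≤ s) (h2 : s ≤ 1) : TimedWord where
  n := 4 * K
  npos := by omega
  σ := fun _ => {0}
  τ := fun j => (num K s j : ℝ) / (8 * K : ℝ)
  sigma_nonempty := fun _ _ => ⟨0, rfl⟩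
  tau_nonneg := by
    intro i _
    have : 0 ≤ num K s i := by unfold num; split_ifs <;> omega
    have : (0 : ℝ) ≤ num K s i := by exact_mod_cast this
    positivity
  tau_zero := by
    have : num K s 0 = 0 := by unfold num; split_ifs <;> omega
    simp [this]
  tau_mono := by
    intro i j hij _
    have : num K s i ≤ num K s j := by unfold num; split_ifs <;> omega
    have : (num K s i : ℝ) ≤ num K s j := by exact_mod_cast this
    gcongr

/-- The first position at distance more than one (or, backwards, the first at distance less). -/
def cut (K : ℕ) (s : ℤ) (i : ℤ) : ℤ :=
  if i < 2 * K then 2 * K + i + (if i = K ∧ s = -1 then 1 else 0)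
  else i - 2 * K + (if i = 3 * K ∧ s = -1 then 0 else 1)

/-! ### Intervals -/

theorem mem_cases (I : TInterval) : ∃ Lo Hi : ℝ → Prop, (∀ t, I.mem t ↔ Lo t ∧ Hi t) ∧
    ((∀ t, Lo t) ∨ (∀ t, ¬ Lo t) ∨ ∃ z : ℤ, I.lo = ((z : ℝ) : EReal) ∧
      ((∀ t, Lo t ↔ (z : ℝ) ≤ t) ∨ (∀ t, Lo t ↔ (z : ℝ) < t))) ∧
    ((∀ t, Hi t) ∨ (∀ t, ¬ Hi t) ∨ ∃ z : ℤ, I.hi = ((z : ℝ) : EReal) ∧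
      ((∀ t, Hi t ↔ t ≤ (z : ℝ)) ∨ (∀ t, Hi t ↔ t < (z : ℝ)))) := by
  refine ⟨fun t => if I.loC then I.lo ≤ (t : EReal) else I.lo < (t : EReal),
    fun t => if I.hiC then (t : EReal) ≤ I.hi else (t : EReal) < I.hi, fun t => Iff.rfl, ?_, ?_⟩
  · rcases I.lo_int with h | h | ⟨z, h⟩
    · left; intro t; rw [h]; cases I.loC <;> simp
    · right; left; intro t; rw [h]; cases I.loC <;> simp
    · right; right
      refine ⟨z, h, ?_⟩
      rw [h]
      cases I.loC
      · right; intro t; simp only [Bool.false_eq_true, if_false, EReal.coe_lt_coe_iff]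
      · left; intro t; simp only [if_true, EReal.coe_le_coe_iff]
  · rcases I.hi_int with h | h | ⟨z, h⟩
    · right; left; intro t; rw [h]; cases I.hiC <;> simp
    · left; intro t; rw [h]; cases I.hiC <;> simp
    · right; right
      refine ⟨z, h, ?_⟩
      rw [h]
      cases I.hiC
      · right; intro t; simp only [Bool.false_eq_true, if_false, EReal.coe_lt_coe_iff]
      · left; intro t; simp only [if_true, EReal.coe_le_coe_iff]

theorem mem_congr (I : TInterval) {t t' : ℝ}
    (h : ∀ z : ℤ, ((z : ℝ) ≤ t ↔ (z : ℝ) ≤ t') ∧ ((z : ℝ) < t ↔ (z : ℝ) < t')) :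
    I.mem t ↔ I.mem t' := by
  obtain ⟨Lo, Hi, hm, hl, hh⟩ := mem_cases I
  rw [hm, hm]
  refine and_congr ?_ ?_
  · rcases hl with hl | hl | ⟨z, _, hl | hl⟩ <;> simp [hl, h]
  · rcases hh with hl | hl | ⟨z, _, hl | hl⟩ <;> simp only [hl]
    · rw [← not_lt, ← not_lt, (h z).2]
    · rw [← not_le, ← not_le, (h z).1]

/-- If `z` is not a left end point, membership near `z` propagates to the left. -/
theorem mem_left (I : TInterval) (z : ℤ) (hz : I.lo ≠ ((z : ℝ) : EReal)) {t t' : ℝ}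
    (h1 : t' ≤ t) (h2 : (z : ℝ) - 1 < t') (h3 : t < z + 1) (h4 : z ≤ t) (h : I.mem t) :
    I.mem t' := by
  obtain ⟨Lo, Hi, hm, hl, hh⟩ := mem_cases I
  rw [hm] at h ⊢
  refine ⟨?_, ?_⟩
  · have key : ∀ w : ℤ, I.lo = ((w : ℝ) : EReal) → (w : ℝ) ≤ t → (w : ℝ) < t' := by
      intro w hw hwt
      have h5 : w ≠ z := by rintro rfl; exact hz hw
      have h6 : (w : ℝ) < z + 1 := by linarith
      have h7 : w < z + 1 := by exact_mod_cast h6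
      have h8 : w ≤ z - 1 := by omega
      have h9 : (w : ℝ) ≤ z - 1 := by exact_mod_cast h8
      linarith
    rcases hl with hl | hl | ⟨w, hw, hl | hl⟩
    · exact hl _
    · exact absurd h.1 (hl _)
    · rw [hl]; exact (key w hw ((hl _).1 h.1)).le
    · rw [hl]; exact (key w hw ((hl _).1 h.1).le)
  · rcases hh with hl | hl | ⟨w, hw, hl | hl⟩
    · exact hl _
    · exact absurd h.2 (hl _)
    · rw [hl]; exact h1.trans ((hl _).1 h.2)
    · rw [hl]; exact h1.trans_lt ((hl _).1 h.2)

/-- If `z` is not a right end point, membership near `z` propagates to the right. -/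
theorem mem_right (I : TInterval) (z : ℤ) (hz : I.hi ≠ ((z : ℝ) : EReal)) {t t' : ℝ}
    (h1 : t ≤ t') (h2 : (z : ℝ) - 1 < t) (h3 : t' < z + 1) (h4 : t ≤ z) (h : I.mem t) :
    I.mem t' := by
  obtain ⟨Lo, Hi, hm, hl, hh⟩ := mem_cases I
  rw [hm] at h ⊢
  refine ⟨?_, ?_⟩
  · rcases hl with hl | hl | ⟨w, hw, hl | hl⟩
    · exact hl _
    · exact absurd h.1 (hl _)
    · rw [hl]; exact ((hl _).1 h.1).trans h1
    · rw [hl]; exact ((hl _).1 h.1).trans_le h1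
  · have key : ∀ w : ℤ, I.hi = ((w : ℝ) : EReal) → t ≤ (w : ℝ) → t' < (w : ℝ) := by
      intro w hw hwt
      have h5 : w ≠ z := by rintro rfl; exact hz hw
      have h6 : (z : ℝ) - 1 < w := by linarith
      have h7 : z - 1 < w := by exact_mod_cast h6
      have h8 : z + 1 ≤ w := by omega
      have h9 : (z : ℝ) + 1 ≤ w := by exact_mod_cast h8
      linarith
    rcases hh with hl | hl | ⟨w, hw, hl | hl⟩
    · exact hl _
    · exact absurd h.2 (hl _)
    · rw [hl]; exact (key w hw ((hl _).1 h.2)).le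
    · rw [hl]; exact (key w hw ((hl _).1 h.2).le)

/-- Membership depends on the region of the numerators only. -/
theorem mem_num (I : TInterval) (K : ℕ) (hK : 0 < K) (d d' : ℤ)
    (b1 : -(16 * K) < d) (b2 : d < 16 * K) (b1' : -(16 * K) < d') (b2' : d' < 16 * K)
    (h1 : d < -(8 * K) ↔ d' < -(8 * K)) (h2 : d ≤ -(8 * K) ↔ d' ≤ -(8 * K))
    (h3 : d < 0 ↔ d' < 0) (h4 : d ≤ 0 ↔ d' ≤ 0)
    (h5 : d < 8 * K ↔ d' < 8 * K) (h6 : d ≤ 8 * K ↔ d' ≤ 8 * K) :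
    I.mem ((d : ℝ) / (8 * K : ℝ)) ↔ I.mem ((d' : ℝ) / (8 * K : ℝ)) := by
  have hKr : (0 : ℝ) < 8 * K := by positivity
  apply mem_congr
  intro z
  rw [le_div_iff₀ hKr, le_div_iff₀ hKr, lt_div_iff₀ hKr, lt_div_iff₀ hKr]
  have e : ((z : ℝ) * (8 * K)) = ((z * (8 * K) : ℤ) : ℝ) := by push_cast; ring
  rw [e]
  simp only [Int.cast_le, Int.cast_lt]
  have hz : z ≤ -2 ∨ z = -1 ∨ z = 0 ∨ z = 1 ∨ 2 ≤ z := by omega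
  rcases hz with hz | rfl | rfl | rfl | hz
  · have : z * (8 * (K : ℤ)) ≤ -2 * (8 * K) := by gcongr
    omega
  · omega
  · omega
  · omega
  · have : 2 * (8 * (K : ℤ)) ≤ z * (8 * K) := by gcongr
    omega

theorem tau_sub (K : ℕ) (hK : 0 < K) (s : ℤ) (h1 : -1 ≤ s) (h2 : s ≤ 1) (i j : ℕ) :
    (wd K hK s h1 h2).τ j - (wd K hK s h1 h2).τ i
      = ((num K s j - num K s i : ℤ) : ℝ) / (8 * K : ℝ) := by
  simp only [wd]
  push_cast
  ring

/-! ### The Ehrenfeucht–Fraïssé argument -/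

/-- Nesting depth. -/
def dep : TPTL → ℕ
  | .and φ ψ => max (dep φ) (dep ψ) + 1
  | .or φ ψ => max (dep φ) (dep ψ) + 1
  | .until φ ψ => max (dep φ) (dep ψ) + 1
  | .since φ ψ => max (dep φ) (dep ψ) + 1
  | .not φ => dep φ + 1
  | .box φ => dep φ + 1
  | .boxm φ => dep φ + 1
  | .freeze φ => dep φ + 1
  | _ => 0

/-- Constants of the game together with the frozen point, its cut and the current point. -/
def cfg (K : ℕ) (i i' c c' j j' : ℤ) : List (ℤ × ℤ) :=
  [(-1, -1), (2 * K, 2 * K), (4 * K, 4 * K), (i, i'), (c, c'), (j, j')]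

theorem cfg_swap (K : ℕ) (i i' c c' j j' : ℤ) :
    (cfg K i i' c c' j j').map Prod.swap = cfg K i' i c' c j' j := by
  simp [cfg]

theorem constr_step (K : ℕ) (hK : 0 < K) (s s' : ℤ) (hs : s = 1 ∨ s = -1) (hs' : s' = 1 ∨ s' = -1)
    (i i' j j' : ℕ) (hi : i < 4 * K) (hi' : i' < 4 * K) (hj : j < 4 * K) (hj' : j' < 4 * K)
    (h : PIso 1 (cfg K i i' (cut K s i) (cut K s' i') j j')) (I : TInterval) :
    I.mem (((num K s j - num K s i : ℤ) : ℝ) / (8 * K : ℝ)) ↔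
      I.mem (((num K s' j' - num K s' i' : ℤ) : ℝ) / (8 * K : ℝ)) := by
  have e1 := h (j, j') (by simp [cfg]) (i, i') (by simp [cfg])
  have e2 := h (j, j') (by simp [cfg]) (cut K s i, cut K s' i') (by simp [cfg])
  have e3 := h (i, i') (by simp [cfg]) (2 * K, 2 * K) (by simp [cfg])
  unfold Close at e1 e2 e3
  dsimp only at e1 e2 e3
  have key : ∀ (s : ℤ) (_ : s = 1 ∨ s = -1) (i j : ℕ) (_ : i < 4 * K) (_ : j < 4 * K),
      (-(16 * K) < num K s j - num K s i ∧ num K s j - num K s i < 16 * K) ∧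
      (num K s j - num K s i ≠ 8 * K ∧ num K s j - num K s i ≠ - (8 * K)) ∧
      (num K s j - num K s i < 0 ↔ j < i) ∧ (num K s j - num K s i ≤ 0 ↔ j ≤ i) ∧
      (i < 2 * K → (num K s j - num K s i < 8 * K ↔ (j : ℤ) < cut K s i) ∧
        - (8 * K) < num K s j - num K s i) ∧
      (2 * K ≤ i → (num K s j - num K s i < -(8 * K) ↔ (j : ℤ) < cut K s i) ∧
        num K s j - num K s i < 8 * K) := by
    intro s hs i j hi hj
    unfold num cut
    rcases hs with rfl | rfl
    · split_ifs <;> first | omega | (exfalso; tauto)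
    · split_ifs <;> first | omega | (exfalso; tauto)
  have k1 := key s hs i j hi hj
  have k2 := key s' hs' i' j' hi' hj'
  generalize num K s j - num K s i = d at *
  generalize num K s' j' - num K s' i' = d' at *
  generalize cut K s i = c at *
  generalize cut K s' i' = c' at *
  clear key h
  by_cases hh : i < 2 * K
  · have hh' : i' < 2 * K := by omega
    have k3 := k1.2.2.2.2.1 hh
    have k4 := k2.2.2.2.2.1 hh'
    apply mem_num I K hK <;> omega
  · have hh' : ¬ i' < 2 * K := by omega
    have k3 := k1.2.2.2.2.2 (by omega)
    have k4 := k2.2.2.2.2.2 (by omega)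
    apply mem_num I K hK <;> omega

theorem freeze_step (K : ℕ) (T : ℤ) (hT : 1 ≤ T) (hKT : 2 * T + 4 ≤ K) (s s' : ℤ)
    (j j' : ℕ) (hj : j < 4 * K) (hj' : j' < 4 * K)
    (h : PIso (T + 3) [(-1, -1), (2 * (K : ℤ), 2 * (K : ℤ)), (4 * (K : ℤ), 4 * (K : ℤ)),
      ((j : ℤ), (j' : ℤ))]) :
    PIso T (cfg K j j' (cut K s j) (cut K s' j') j j') := by
  have e1 := h (j, j') (by simp) (-1, -1) (by simp)
  have e2 := h (j, j') (by simp) (2 * K, 2 * K) (by simp)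
  have e3 := h (j, j') (by simp) (4 * K, 4 * K) (by simp)
  have base : PIso T [((j : ℤ), (j' : ℤ)), (-1, -1), (2 * (K : ℤ), 2 * (K : ℤ)),
      (4 * (K : ℤ), 4 * (K : ℤ))] :=
    (h.weaken (by omega)).sub (by intro x hx; simp at hx ⊢; tauto)
  have main : PIso T ((cut K s j, cut K s' j') :: [((j : ℤ), (j' : ℤ)), (-1, -1),
      (2 * (K : ℤ), 2 * (K : ℤ)), (4 * (K : ℤ), 4 * (K : ℤ))]) := by
    apply base.cons
    unfold Close at *
    dsimp only at *
    have hj2 : (j : ℤ) < 2 * K ↔ (j' : ℤ) < 2 * K := by omega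
    unfold cut
    intro p hp
    simp only [List.mem_cons, List.not_mem_nil, or_false] at hp
    rcases hp with rfl | rfl | rfl | rfl <;> dsimp only <;> split_ifs <;> omega
  refine main.sub ?_
  intro x hx
  simp [cfg] at hx ⊢
  tauto

theorem ef (K : ℕ) (hK : 0 < K) : ∀ (φ : TPTL) (n : ℕ), dep φ ≤ n → 4 * 4 ^ (n + 1) ≤ K →
    ∀ (s s' : ℤ) (h1 : -1 ≤ s) (h2 : s ≤ 1) (h1' : -1 ≤ s') (h2' : s' ≤ 1),
    (s = 1 ∨ s = -1) → (s' = 1 ∨ s' = -1) →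
    ∀ i i' j j' : ℕ, i < 4 * K → i' < 4 * K → j < 4 * K → j' < 4 * K →
    PIso (4 ^ (n + 1)) (cfg K i i' (cut K s i) (cut K s' i') j j') →
    φ.sat (wd K hK s h1 h2) j ((wd K hK s h1 h2).τ i) →
    φ.sat (wd K hK s' h1' h2') j' ((wd K hK s' h1' h2').τ i') := by
  have pick : ∀ (T : ℤ) (S : List (ℤ × ℤ)), 0 < T → PIso (2 * T) S → (-1, -1) ∈ S →
      (4 * (K : ℤ), 4 * (K : ℤ)) ∈ S → ∀ x : ℕ, x < 4 * K →
      ∃ y : ℕ, y < 4 * K ∧ PIso T (((x : ℤ), (y : ℤ)) :: S) := by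
    intro T S hT hS m1 m2 x hx
    obtain ⟨y, hy⟩ := hS.ext hT (x : ℤ) _ m1 (by dsimp only; omega)
    have e1 := hy (x, y) (by simp) (-1, -1) (by simp [m1])
    have e2 := hy (x, y) (by simp) (4 * K, 4 * K) (by simp [m2])
    unfold Close at e1 e2
    dsimp only at e1 e2
    obtain ⟨y, rfl⟩ := Int.eq_ofNat_of_zero_le (show 0 ≤ y by omega)
    exact ⟨y, by omega, hy⟩
  have pick' : ∀ (T : ℤ) (S : List (ℤ × ℤ)), 0 < T → PIso (2 * T) S → (-1, -1) ∈ S →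
      (4 * (K : ℤ), 4 * (K : ℤ)) ∈ S → ∀ y : ℕ, y < 4 * K →
      ∃ x : ℕ, x < 4 * K ∧ PIso T (((x : ℤ), (y : ℤ)) :: S) := by
    intro T S hT hS m1 m2 y hy
    obtain ⟨x, hx⟩ := hS.ext' hT (y : ℤ) _ m1 (by dsimp only; omega)
    have e1 := hx (x, y) (by simp) (-1, -1) (by simp [m1])
    have e2 := hx (x, y) (by simp) (4 * K, 4 * K) (by simp [m2])
    unfold Close at e1 e2
    dsimp only at e1 e2
    obtain ⟨x, rfl⟩ := Int.eq_ofNat_of_zero_le (show 0 ≤ x by omega)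
    exact ⟨x, by omega, hx⟩
  have ord : ∀ (T : ℤ) (S : List (ℤ × ℤ)), 0 < T → PIso T S → ∀ x y x' y' : ℕ,
      ((x : ℤ), (y : ℤ)) ∈ S → ((x' : ℤ), (y' : ℤ)) ∈ S → (x < x' ↔ y < y') := by
    intro T S hT hS x y x' y' h1 h2
    have e := hS _ h1 _ h2
    unfold Close at e
    dsimp only at e
    omega
  have recfg : ∀ (T T' : ℤ) (S : List (ℤ × ℤ)) (i i' c c' j j' x y : ℤ), PIso T S → T' ≤ T →
      cfg K i i' c c' j j' ⊆ S → (x, y) ∈ S → PIso T' (cfg K i i' c c' x y) := by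
    intro T T' S i i' c c' j j' x y hS hT hsub hm
    refine (hS.weaken hT).sub ?_
    intro z hz
    simp only [cfg, List.mem_cons, List.not_mem_nil, or_false] at hz
    rcases hz with rfl | rfl | rfl | rfl | rfl | rfl
    all_goals first | exact hm | exact hsub (by simp [cfg])
  intro φ
  induction φ with
  | atom a => intro n _ _ s s' _ _ _ _ _ _ i i' j j' _ _ _ _ _ h; exact h
  | tt => intros; trivial
  | ff => intro n _ _ s s' _ _ _ _ _ _ i i' j j' _ _ _ _ _ h; exact h
  | constr I =>
    intro n _ hn s s' h1 h2 h1' h2' hs hs' i i' j j' hi hi' hj hj' hP h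
    simp only [TPTL.sat] at h ⊢
    rw [tau_sub] at h ⊢
    have hp : (1 : ℤ) ≤ 4 ^ (n + 1) := one_le_pow₀ (by norm_num)
    exact (constr_step K hK s s' hs hs' i i' j j' hi hi' hj hj' (hP.weaken hp) I).1 h
  | freeze φ ih =>
    intro n hd hn s s' h1 h2 h1' h2' hs hs' i i' j j' hi hi' hj hj' hP h
    simp only [dep] at hd
    obtain ⟨m, rfl⟩ : ∃ m, n = m + 1 := ⟨n - 1, by omega⟩
    have e4 : (4 : ℤ) ^ (m + 1 + 1) = 4 * 4 ^ (m + 1) := by ring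
    have e4' : (4 : ℕ) ^ (m + 1 + 1) = 4 * 4 ^ (m + 1) := by ring
    have hp : (1 : ℤ) ≤ 4 ^ (m + 1) := one_le_pow₀ (by norm_num)
    have hnz : ((4 * 4 ^ (m + 1 + 1) : ℕ) : ℤ) ≤ (K : ℤ) := by exact_mod_cast hn
    push_cast at hnz
    refine ih m (by omega) (by omega) s s' h1 h2 h1' h2' hs hs' j j' j j' hj hj' hj hj' ?_ h
    apply freeze_step K _ hp (by omega) s s' j j' hj hj'
    refine (hP.weaken (by omega)).sub ?_
    intro x hx
    simp [cfg] at hx ⊢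
    tauto
  | and φ ψ ih1 ih2 =>
    intro n hd hn s s' h1 h2 h1' h2' hs hs' i i' j j' hi hi' hj hj' hP h
    simp only [dep] at hd
    exact ⟨ih1 n (by omega) hn s s' h1 h2 h1' h2' hs hs' i i' j j' hi hi' hj hj' hP h.1,
      ih2 n (by omega) hn s s' h1 h2 h1' h2' hs hs' i i' j j' hi hi' hj hj' hP h.2⟩
  | or φ ψ ih1 ih2 =>
    intro n hd hn s s' h1 h2 h1' h2' hs hs' i i' j j' hi hi' hj hj' hP h
    simp only [dep] at hd
    exact h.imp (ih1 n (by omega) hn s s' h1 h2 h1' h2' hs hs' i i' j j' hi hi' hj hj' hP)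
      (ih2 n (by omega) hn s s' h1 h2 h1' h2' hs hs' i i' j j' hi hi' hj hj' hP)
  | not φ ih =>
    intro n hd hn s s' h1 h2 h1' h2' hs hs' i i' j j' hi hi' hj hj' hP h
    simp only [dep] at hd
    intro h'
    apply h
    refine ih n (by omega) hn s' s h1' h2' h1 h2 hs' hs i' i j' j hi' hi hj' hj ?_ h'
    rw [← cfg_swap]
    exact hP.swap
  | since φ ψ ih1 ih2 =>
    intro n hd hn s s' h1 h2 h1' h2' hs hs' i i' j j' hi hi' hj hj' hP h
    simp only [dep] at hd
    obtain ⟨m, rfl⟩ : ∃ m, n = m + 1 := ⟨n - 1, by omega⟩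
    have e4 : (4 : ℤ) ^ (m + 1 + 1) = 2 * (2 * 4 ^ (m + 1)) := by ring
    have e4' : (4 : ℕ) ^ (m + 1 + 1) = 4 * 4 ^ (m + 1) := by ring
    have hp : (1 : ℤ) ≤ 4 ^ (m + 1) := one_le_pow₀ (by norm_num)
    rw [e4] at hP
    obtain ⟨l, hjl, hψ, hφ⟩ := h
    have hl : l < 4 * K := by omega
    obtain ⟨l', hl', hP1⟩ := pick _ _ (by omega) hP (by simp [cfg]) (by simp [cfg]) l hl
    have o1 := ord _ _ (by omega) hP1 l l' j j' (by simp) (by simp [cfg])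
    refine ⟨l', o1.1 hjl, ?_, ?_⟩
    · refine ih2 m (by omega) (by omega) s s' h1 h2 h1' h2' hs hs' i i' l l' hi hi' hl hl' ?_ hψ
      exact recfg _ _ _ _ _ _ _ j j' _ _ hP1 (by omega) (by simp) (by simp)
    · intro k' hk1 hk2
      obtain ⟨k, hk, hP2⟩ := pick' _ _ (by omega) hP1 (by simp [cfg]) (by simp [cfg]) k'
        (by omega)
      have o2 := ord _ _ (by omega) hP2 k k' j j' (by simp) (by simp [cfg])
      have o3 := ord _ _ (by omega) hP2 l l' k k' (by simp) (by simp)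
      refine ih1 m (by omega) (by omega) s s' h1 h2 h1' h2' hs hs' i i' k k' hi hi' hk
        (by omega) ?_ (hφ k (o3.2 hk1) (o2.2 hk2))
      exact recfg _ _ _ _ _ _ _ j j' _ _ hP2 (by omega)
        (fun z hz => by simp [hz]) (by simp)
  | box φ ih =>
    intro n hd hn s s' h1 h2 h1' h2' hs hs' i i' j j' hi hi' hj hj' hP h
    simp only [dep] at hd
    obtain ⟨m, rfl⟩ : ∃ m, n = m + 1 := ⟨n - 1, by omega⟩
    have e4 : (4 : ℤ) ^ (m + 1 + 1) = 2 * (2 * 4 ^ (m + 1)) := by ring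
    have e4' : (4 : ℕ) ^ (m + 1 + 1) = 4 * 4 ^ (m + 1) := by ring
    have hp : (1 : ℤ) ≤ 4 ^ (m + 1) := one_le_pow₀ (by norm_num)
    rw [e4] at hP
    intro l' hjl' hl'
    have hl2 : l' < 4 * K := hl'
    obtain ⟨l, hl, hP1⟩ := pick' _ _ (by omega) hP (by simp [cfg]) (by simp [cfg]) l' hl2
    have o1 := ord _ _ (by omega) hP1 j j' l l' (by simp [cfg]) (by simp)
    refine ih m (by omega) (by omega) s s' h1 h2 h1' h2' hs hs' i i' l l' hi hi' hl hl2 ?_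
      (h l (o1.2 hjl') hl)
    exact recfg _ _ _ _ _ _ _ j j' _ _ hP1 (by omega) (by simp) (by simp)
  | boxm φ ih =>
    intro n hd hn s s' h1 h2 h1' h2' hs hs' i i' j j' hi hi' hj hj' hP h
    simp only [dep] at hd
    obtain ⟨m, rfl⟩ : ∃ m, n = m + 1 := ⟨n - 1, by omega⟩
    have e4 : (4 : ℤ) ^ (m + 1 + 1) = 2 * (2 * 4 ^ (m + 1)) := by ring
    have e4' : (4 : ℕ) ^ (m + 1 + 1) = 4 * 4 ^ (m + 1) := by ring
    have hp : (1 : ℤ) ≤ 4 ^ (m + 1) := one_le_pow₀ (by norm_num)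
    rw [e4] at hP
    intro l' hjl'
    have hl2 : l' < 4 * K := by omega
    obtain ⟨l, hl, hP1⟩ := pick' _ _ (by omega) hP (by simp [cfg]) (by simp [cfg]) l' hl2
    have o1 := ord _ _ (by omega) hP1 l l' j j' (by simp) (by simp [cfg])
    refine ih m (by omega) (by omega) s s' h1 h2 h1' h2' hs hs' i i' l l' hi hi' hl hl2 ?_
      (h l (o1.2 hjl'))
    exact recfg _ _ _ _ _ _ _ j j' _ _ hP1 (by omega) (by simp) (by simp)
  | _ φ ψ ih1 ih2 =>
    intro n hd hn s s' h1 h2 h1' h2' hs hs' i i' j j' hi hi' hj hj' hP h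
    simp only [dep] at hd
    obtain ⟨m, rfl⟩ : ∃ m, n = m + 1 := ⟨n - 1, by omega⟩
    have e4 : (4 : ℤ) ^ (m + 1 + 1) = 2 * (2 * 4 ^ (m + 1)) := by ring
    have e4' : (4 : ℕ) ^ (m + 1 + 1) = 4 * 4 ^ (m + 1) := by ring
    have hp : (1 : ℤ) ≤ 4 ^ (m + 1) := one_le_pow₀ (by norm_num)
    rw [e4] at hP
    obtain ⟨l, hjl, hl, hψ, hφ⟩ := h
    obtain ⟨l', hl', hP1⟩ := pick _ _ (by omega) hP (by simp [cfg]) (by simp [cfg]) l hl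
    have o1 := ord _ _ (by omega) hP1 j j' l l' (by simp [cfg]) (by simp)
    refine ⟨l', o1.1 hjl, hl', ?_, ?_⟩
    · refine ih2 m (by omega) (by omega) s s' h1 h2 h1' h2' hs hs' i i' l l' hi hi' hl hl' ?_ hψ
      exact recfg _ _ _ _ _ _ _ j j' _ _ hP1 (by omega) (by simp) (by simp)
    · intro k' hk1 hk2
      obtain ⟨k, hk, hP2⟩ := pick' _ _ (by omega) hP1 (by simp [cfg]) (by simp [cfg]) k'
        (by omega)
      have o2 := ord _ _ (by omega) hP2 j j' k k' (by simp [cfg]) (by simp)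
      have o3 := ord _ _ (by omega) hP2 k k' l l' (by simp) (by simp)
      refine ih1 m (by omega) (by omega) s s' h1 h2 h1' h2' hs hs' i i' k k' hi hi' hk
        (by omega) ?_ (hφ k (o2.2 hk1) (o3.2 hk2))
      exact recfg _ _ _ _ _ _ _ j j' _ _ hP2 (by omega)
        (fun z hz => by simp [hz]) (by simp)

/-! ### Sandwiching the word with an exact match -/

/-- Constraint at `j` relative to frozen position `i` in the word with shift `s`. -/
def cmem (K : ℕ) (s : ℤ) (I : TInterval) (i j : ℕ) : Prop :=
  I.mem (((num K s j - num K s i : ℤ) : ℝ) / (8 * K : ℝ))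

theorem cmem_same (K : ℕ) (hK : 0 < K) (s s' : ℤ) (h1 : -1 ≤ s) (h2 : s ≤ 1) (h1' : -1 ≤ s')
    (h2' : s' ≤ 1) (I : TInterval) (i j : ℕ) (hi : i < 4 * K) (hj : j < 4 * K)
    (hne1 : ¬ (i = K ∧ j = 3 * K)) (hne2 : ¬ (i = 3 * K ∧ j = K)) :
    cmem K s I i j ↔ cmem K s' I i j := by
  unfold cmem
  have key : ∃ d d' : ℤ, num K s j - num K s i = d ∧ num K s' j - num K s' i = d' ∧
      (-(16 * K) < d ∧ d < 16 * K ∧ -(16 * K) < d' ∧ d' < 16 * K) ∧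
    (d < -(8 * K) ↔ d' < -(8 * K)) ∧ (d ≤ -(8 * K) ↔ d' ≤ -(8 * K)) ∧
    (d < 0 ↔ d' < 0) ∧ (d ≤ 0 ↔ d' ≤ 0) ∧ (d < 8 * K ↔ d' < 8 * K) ∧
    (d ≤ 8 * K ↔ d' ≤ 8 * K) := by
    refine ⟨_, _, rfl, rfl, ?_⟩
    unfold num
    split_ifs <;> omega
  obtain ⟨d, d', e, e', ⟨a1, a2, a3, a4⟩, b1, b2, b3, b4, b5, b6⟩ := key
  rw [e, e']
  exact mem_num I K hK d d' a1 a2 a3 a4 b1 b2 b3 b4 b5 b6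

theorem near_left (K : ℕ) (hK : 0 < K) (I : TInterval) (z : ℤ) (hz : I.lo ≠ ((z : ℝ) : EReal))
    (d d' e e' : ℤ) (hd : d = 8 * K * z + e) (hd' : d' = 8 * K * z + e')
    (h1 : -1 ≤ e') (h2 : e' ≤ e) (h3 : e ≤ 1) (h4 : 0 ≤ e)
    (h : I.mem ((d : ℝ) / (8 * K : ℝ))) : I.mem ((d' : ℝ) / (8 * K : ℝ)) := by
  have hKr : (1 : ℝ) ≤ K := by exact_mod_cast hK
  have hp : (0 : ℝ) < 8 * K := by linarith
  have h1r : (-1 : ℝ) ≤ e' := by exact_mod_cast h1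
  have h2r : (e' : ℝ) ≤ e := by exact_mod_cast h2
  have h3r : (e : ℝ) ≤ 1 := by exact_mod_cast h3
  have h4r : (0 : ℝ) ≤ e := by exact_mod_cast h4
  have hdr : (d : ℝ) = 8 * K * z + e := by rw [hd]; push_cast; ring
  have hdr' : (d' : ℝ) = 8 * K * z + e' := by rw [hd']; push_cast; ring
  refine mem_left I z hz (t := (d : ℝ) / (8 * K : ℝ)) ?_ ?_ ?_ ?_ h
  · rw [div_le_div_iff_of_pos_right hp]; linarith
  · rw [lt_div_iff₀ hp]; nlinarith
  · rw [div_lt_iff₀ hp]; nlinarith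
  · rw [le_div_iff₀ hp]; nlinarith

theorem near_right (K : ℕ) (hK : 0 < K) (I : TInterval) (z : ℤ) (hz : I.hi ≠ ((z : ℝ) : EReal))
    (d d' e e' : ℤ) (hd : d = 8 * K * z + e) (hd' : d' = 8 * K * z + e')
    (h1 : -1 ≤ e) (h2 : e ≤ e') (h3 : e' ≤ 1) (h4 : e ≤ 0)
    (h : I.mem ((d : ℝ) / (8 * K : ℝ))) : I.mem ((d' : ℝ) / (8 * K : ℝ)) := by
  have hKr : (1 : ℝ) ≤ K := by exact_mod_cast hK
  have hp : (0 : ℝ) < 8 * K := by linarith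
  have h1r : (-1 : ℝ) ≤ e := by exact_mod_cast h1
  have h2r : (e : ℝ) ≤ e' := by exact_mod_cast h2
  have h3r : (e' : ℝ) ≤ 1 := by exact_mod_cast h3
  have h4r : (e : ℝ) ≤ 0 := by exact_mod_cast h4
  have hdr : (d : ℝ) = 8 * K * z + e := by rw [hd]; push_cast; ring
  have hdr' : (d' : ℝ) = 8 * K * z + e' := by rw [hd']; push_cast; ring
  refine mem_right I z hz (t := (d : ℝ) / (8 * K : ℝ)) ?_ ?_ ?_ ?_ h
  · rw [div_le_div_iff_of_pos_right hp]; linarith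
  · rw [lt_div_iff₀ hp]; nlinarith
  · rw [div_lt_iff₀ hp]; nlinarith
  · rw [div_le_iff₀ hp]; nlinarith

theorem one_sided (L : List TInterval) (hL : ∀ I ∈ L, ∀ I' ∈ L, NonAdj I I') (z : ℤ)
    (hz : z ≠ 0) : (∀ I ∈ L, I.lo ≠ ((z : ℝ) : EReal)) ∨ (∀ I ∈ L, I.hi ≠ ((z : ℝ) : EReal)) := by
  by_contra hcon
  push Not at hcon
  obtain ⟨⟨I, hI, h1⟩, ⟨I', hI', h2⟩⟩ := hcon
  have h3 := (hL I hI I' hI').2 (by simp only [TInterval.inf, TInterval.sup, h1, h2])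
  simp only [TInterval.inf, h1] at h3
  apply hz
  exact_mod_cast h3

theorem dichotomy (K : ℕ) (hK : 0 < K) (L : List TInterval)
    (hL : ∀ I ∈ L, ∀ I' ∈ L, NonAdj I I') (i : ℕ) (hi : i < 4 * K) :
    (∀ I ∈ L, ∀ l < 4 * K, (cmem K 1 I i l → cmem K 0 I i l) ∧ (cmem K 0 I i l → cmem K (-1) I i l))
    ∨ (∀ I ∈ L, ∀ l < 4 * K,
      (cmem K (-1) I i l → cmem K 0 I i l) ∧ (cmem K 0 I i l → cmem K 1 I i l)) := by
  have same : ∀ s s' : ℤ, -1 ≤ s → s ≤ 1 → -1 ≤ s' → s' ≤ 1 → ∀ I : TInterval, ∀ l < 4 * K,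
      ¬ (i = K ∧ l = 3 * K) → ¬ (i = 3 * K ∧ l = K) → cmem K s I i l → cmem K s' I i l :=
    fun s s' a b c d I l hl n1 n2 => (cmem_same K hK s s' a b c d I i l hi hl n1 n2).1
  have n1 : ∀ s, num K s K = 4 * K := by intro s; unfold num; split_ifs <;> omega
  have n2 : ∀ s, num K s (3 * K) = 12 * K + s := by
    intro s; unfold num; split_ifs <;> push_cast <;> omega
  by_cases hiK : i = K
  · rcases one_sided L hL 1 (by norm_num) with ho | ho
    · left
      intro I hI l hl
      by_cases hlK : l = 3 * K
      · subst hlK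
        rw [hiK]
        unfold cmem
        simp only [n1, n2]
        exact ⟨near_left K hK I 1 (ho I hI) _ _ 1 0 (by ring) (by ring) (by omega) (by omega)
          (by omega) (by omega), near_left K hK I 1 (ho I hI) _ _ 0 (-1) (by ring) (by ring)
          (by omega) (by omega) (by omega) (by omega)⟩
      · exact ⟨same 1 0 (by omega) (by omega) (by omega) (by omega) I l hl (by omega) (by omega),
          same 0 (-1) (by omega) (by omega) (by omega) (by omega) I l hl (by omega) (by omega)⟩
    · right
      intro I hI l hl
      by_cases hlK : l = 3 * K
      · subst hlK
        rw [hiK]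
        unfold cmem
        simp only [n1, n2]
        exact ⟨near_right K hK I 1 (ho I hI) _ _ (-1) 0 (by ring) (by ring) (by omega) (by omega)
          (by omega) (by omega), near_right K hK I 1 (ho I hI) _ _ 0 1 (by ring) (by ring)
          (by omega) (by omega) (by omega) (by omega)⟩
      · exact ⟨same (-1) 0 (by omega) (by omega) (by omega) (by omega) I l hl (by omega) (by omega),
          same 0 1 (by omega) (by omega) (by omega) (by omega) I l hl (by omega) (by omega)⟩
  by_cases hiK3 : i = 3 * K
  · rcases one_sided L hL (-1) (by norm_num) with ho | ho
    · right
      intro I hI l hl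
      by_cases hlK : l = K
      · rw [hiK3, hlK]
        unfold cmem
        simp only [n1, n2]
        exact ⟨near_left K hK I (-1) (ho I hI) _ _ 1 0 (by ring) (by ring) (by omega) (by omega)
          (by omega) (by omega), near_left K hK I (-1) (ho I hI) _ _ 0 (-1) (by ring) (by ring)
          (by omega) (by omega) (by omega) (by omega)⟩
      · exact ⟨same (-1) 0 (by omega) (by omega) (by omega) (by omega) I l hl (by omega) (by omega),
          same 0 1 (by omega) (by omega) (by omega) (by omega) I l hl (by omega) (by omega)⟩
    · left
      intro I hI l hl
      by_cases hlK : l = K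
      · rw [hiK3, hlK]
        unfold cmem
        simp only [n1, n2]
        exact ⟨near_right K hK I (-1) (ho I hI) _ _ (-1) 0 (by ring) (by ring) (by omega) (by omega)
          (by omega) (by omega), near_right K hK I (-1) (ho I hI) _ _ 0 1 (by ring) (by ring)
          (by omega) (by omega) (by omega) (by omega)⟩
      · exact ⟨same 1 0 (by omega) (by omega) (by omega) (by omega) I l hl (by omega) (by omega),
          same 0 (-1) (by omega) (by omega) (by omega) (by omega) I l hl (by omega) (by omega)⟩
  left
  intro I hI l hl
  exact ⟨same 1 0 (by omega) (by omega) (by omega) (by omega) I l hl (by omega) (by omega),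
    same 0 (-1) (by omega) (by omega) (by omega) (by omega) I l hl (by omega) (by omega)⟩

theorem na_main (K : ℕ) (hK : 0 < K) : ∀ (φ : TPTL), φ.IsNNF → φ.ScopedPairs NonAdj →
    ∀ n, dep φ ≤ n → 4 * 4 ^ (n + 1) ≤ K →
    ∀ (s s' : ℤ) (h1 : -1 ≤ s) (h2 : s ≤ 1) (h1' : -1 ≤ s') (h2' : s' ≤ 1),
    ∀ i j : ℕ, i < 4 * K → j < 4 * K →
    (∀ I ∈ φ.freeIntervals, ∀ l < 4 * K, cmem K s I i l → cmem K s' I i l) →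
    φ.sat (wd K hK s h1 h2) j ((wd K hK s h1 h2).τ i) →
    φ.sat (wd K hK s' h1' h2') j ((wd K hK s' h1' h2').τ i) := by
  intro φ
  induction φ with
  | atom a => intro _ _ n _ _ s s' _ _ _ _ i j _ _ _ h; exact h
  | tt => intros; trivial
  | ff => intro _ _ n _ _ s s' _ _ _ _ i j _ _ _ h; exact h
  | constr I =>
    intro _ _ n _ _ s s' h1 h2 h1' h2' i j _ hj hf h
    simp only [TPTL.sat] at h ⊢
    rw [tau_sub] at h ⊢
    exact hf I (by simp [TPTL.freeIntervals]) j hj h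
  | not φ ih =>
    intro hn _ n _ _ s s' _ _ _ _ i j _ _ _ h
    cases φ <;> first | exact h | exact hn.elim
  | freeze φ ih =>
    intro hn hsc n hd hK4 s s' h1 h2 h1' h2' i j hi hj _ h
    simp only [dep] at hd
    have e4' : (4 : ℕ) ^ (n + 1) = 4 * 4 ^ n := by ring
    obtain ⟨m, rfl⟩ : ∃ m, n = m + 1 := ⟨n - 1, by omega⟩
    have hm : 4 * 4 ^ (m + 1) ≤ K := by omega
    have hp : (1 : ℤ) ≤ 4 ^ (m + 1) := one_le_pow₀ (by norm_num)
    have hnz : ((4 * 4 ^ (m + 1 + 1) : ℕ) : ℤ) ≤ (K : ℤ) := by exact_mod_cast hK4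
    rw [e4'] at hnz
    push_cast at hnz
    have go := fun (s s' : ℤ) (h1 : -1 ≤ s) (h2 : s ≤ 1) (h1' : -1 ≤ s') (h2' : s' ≤ 1) =>
      ih hn hsc.2 m (by omega) hm s s' h1 h2 h1' h2' j j hj hj
    have piso : ∀ s s' : ℤ, PIso (4 ^ (m + 1)) (cfg K j j (cut K s j) (cut K s' j) j j) := by
      intro s s'
      apply freeze_step K _ hp (by omega) s s' j j hj hj
      intro p hp q hq
      simp only [List.mem_cons, List.not_mem_nil, or_false] at hp hq
      left
      rcases hp with rfl | rfl | rfl | rfl <;> rcases hq with rfl | rfl | rfl | rfl <;> rfl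
    have f1 := ef K hK φ m (by omega) hm 1 (-1) (by omega) (by omega) (by omega) (by omega)
      (by omega) (by omega) j j j j hj hj hj hj (piso _ _)
    have f2 := ef K hK φ m (by omega) hm (-1) 1 (by omega) (by omega) (by omega) (by omega)
      (by omega) (by omega) j j j j hj hj hj hj (piso _ _)
    simp only [TPTL.sat] at h ⊢
    have hs : s = -1 ∨ s = 0 ∨ s = 1 := by omega
    have hs' : s' = -1 ∨ s' = 0 ∨ s' = 1 := by omega
    rcases dichotomy K hK φ.freeIntervals hsc.1 j hj with D | D
    · have g1 := go 1 0 (by omega) (by omega) (by omega) (by omega)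
        (fun I hI l hl => (D I hI l hl).1)
      have g2 := go 0 (-1) (by omega) (by omega) (by omega) (by omega)
        (fun I hI l hl => (D I hI l hl).2)
      rcases hs with rfl | rfl | rfl <;> rcases hs' with rfl | rfl | rfl
      all_goals first | exact h | exact g1 h | exact g2 h | exact f2 h | exact g2 (g1 h) | exact f2 (g2 h) | exact g1 (f2 h)
    · have g1 := go (-1) 0 (by omega) (by omega) (by omega) (by omega)
        (fun I hI l hl => (D I hI l hl).1)
      have g2 := go 0 1 (by omega) (by omega) (by omega) (by omega)
        (fun I hI l hl => (D I hI l hl).2)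
      rcases hs with rfl | rfl | rfl <;> rcases hs' with rfl | rfl | rfl
      all_goals first | exact h | exact g1 h | exact g2 h | exact f1 h | exact g2 (g1 h) | exact f1 (g2 h) | exact g1 (f1 h)
  | and φ ψ ih1 ih2 =>
    intro hn hsc n hd hK4 s s' h1 h2 h1' h2' i j hi hj hf h
    simp only [dep] at hd
    simp only [TPTL.freeIntervals, List.mem_append] at hf
    exact ⟨ih1 hn.1 hsc.1 n (by omega) hK4 s s' h1 h2 h1' h2' i j hi hj
        (fun I hI => hf I (Or.inl hI)) h.1,
      ih2 hn.2 hsc.2 n (by omega) hK4 s s' h1 h2 h1' h2' i j hi hj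
        (fun I hI => hf I (Or.inr hI)) h.2⟩
  | or φ ψ ih1 ih2 =>
    intro hn hsc n hd hK4 s s' h1 h2 h1' h2' i j hi hj hf h
    simp only [dep] at hd
    simp only [TPTL.freeIntervals, List.mem_append] at hf
    exact h.imp (ih1 hn.1 hsc.1 n (by omega) hK4 s s' h1 h2 h1' h2' i j hi hj
        (fun I hI => hf I (Or.inl hI)))
      (ih2 hn.2 hsc.2 n (by omega) hK4 s s' h1 h2 h1' h2' i j hi hj
        (fun I hI => hf I (Or.inr hI)))
  | since φ ψ ih1 ih2 =>
    intro hn hsc n hd hK4 s s' h1 h2 h1' h2' i j hi hj hf h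
    simp only [dep] at hd
    simp only [TPTL.freeIntervals, List.mem_append] at hf
    obtain ⟨l, hjl, hψ, hφ⟩ := h
    exact ⟨l, hjl, ih2 hn.2 hsc.2 n (by omega) hK4 s s' h1 h2 h1' h2' i l hi (by omega)
        (fun I hI => hf I (Or.inr hI)) hψ,
      fun k hk1 hk2 => ih1 hn.1 hsc.1 n (by omega) hK4 s s' h1 h2 h1' h2' i k hi (by omega)
        (fun I hI => hf I (Or.inl hI)) (hφ k hk1 hk2)⟩
  | box φ ih =>
    intro hn hsc n hd hK4 s s' h1 h2 h1' h2' i j hi hj hf h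
    simp only [dep] at hd
    exact fun l hl hl2 => ih hn hsc n (by omega) hK4 s s' h1 h2 h1' h2' i l hi hl2 hf (h l hl hl2)
  | boxm φ ih =>
    intro hn hsc n hd hK4 s s' h1 h2 h1' h2' i j hi hj hf h
    simp only [dep] at hd
    exact fun l hl => ih hn hsc n (by omega) hK4 s s' h1 h2 h1' h2' i l hi (by omega) hf (h l hl)
  | _ φ ψ ih1 ih2 =>
    intro hn hsc n hd hK4 s s' h1 h2 h1' h2' i j hi hj hf h
    simp only [dep] at hd
    simp only [TPTL.freeIntervals, List.mem_append] at hf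
    obtain ⟨l, hjl, hl, hψ, hφ⟩ := h
    have hl2 : l < 4 * K := hl
    exact ⟨l, hjl, hl, ih2 hn.2 hsc.2 n (by omega) hK4 s s' h1 h2 h1' h2' i l hi hl2
        (fun I hI => hf I (Or.inr hI)) hψ,
      fun k hk1 hk2 => ih1 hn.1 hsc.1 n (by omega) hK4 s s' h1 h2 h1' h2' i k hi (by omega)
        (fun I hI => hf I (Or.inl hI)) (hφ k hk1 hk2)⟩

/-- The punctual interval `[1,1]`. -/
noncomputable def one : TInterval where
  lo := ((1 : ℝ) : EReal)
  hi := ((1 : ℝ) : EReal)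
  loC := true
  hiC := true
  lo_int := Or.inr (Or.inr ⟨1, by norm_num⟩)
  hi_int := Or.inr (Or.inr ⟨1, by norm_num⟩)

theorem one_mem (t : ℝ) : one.mem t ↔ t = 1 := by
  simp only [one, TInterval.mem, if_true, EReal.coe_le_coe_iff]
  constructor
  · rintro ⟨h1, h2⟩; exact le_antisymm h2 h1
  · rintro rfl; exact ⟨le_rfl, le_rfl⟩

/-- Some two later events are at distance exactly one. -/
noncomputable def psi : TPTL := .until .tt (.freeze (.until .tt (.constr one)))

/-- Partially adjacent 1-TPTL is strictly more expressive
than non-adjacent 1-TPTL: every NA-1-TPTL formula is a PA-1-TPTL formula, and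
some PA-1-TPTL formula is not language-equivalent to any NA-1-TPTL formula. -/
theorem pa_strictly_more_expressive_than_na :
    (∀ φ : TPTL, φ.IsNNF → φ.IsNA → φ.IsPA) ∧
    (∃ ψ : TPTL, ψ.IsNNF ∧ ψ.IsPA ∧
      ∀ φ : TPTL, φ.IsNNF → φ.IsNA →
        ¬ (∀ ρ : TimedWord, TPTL.Models ρ ψ ↔ TPTL.Models ρ φ)) := by
  refine ⟨fun φ _ hφ => Or.inl (ScopedPairs.mono ?_ φ hφ), psi, ?_, Or.inr ?_, ?_⟩
  · exact fun I I' h => ⟨fun e => (h.1 e).le, fun e => (h.2 e).le⟩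
  · exact ⟨trivial, trivial, trivial⟩
  · refine ⟨trivial, ?_, trivial, trivial⟩
    have h01 : (0 : EReal) ≤ ((1 : ℝ) : EReal) := by
      rw [← EReal.coe_zero, EReal.coe_le_coe_iff]; norm_num
    intro I hI I' hI'
    simp only [TPTL.freeIntervals, List.nil_append, List.mem_singleton] at hI hI'
    subst hI
    exact ⟨fun _ => h01, fun _ => h01⟩
  · intro φ hn hna heq
    obtain ⟨K, hKe⟩ : ∃ K : ℕ, K = 4 * 4 ^ (dep φ + 1) := ⟨_, rfl⟩
    have hK : 0 < K := by rw [hKe]; positivity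
    have a1 := heq (wd K hK 0 (by omega) (by omega))
    have a2 := heq (wd K hK 1 (by omega) (by omega))
    have hKr : (0 : ℝ) < 8 * K := by positivity
    have p0 : TPTL.Models (wd K hK 0 (by omega) (by omega)) psi := by
      refine ⟨K, hK, ?_, ⟨3 * K, by omega, ?_, ?_, fun _ _ _ => trivial⟩, fun _ _ _ => trivial⟩
      · change K < 4 * K; omega
      · change 3 * K < 4 * K; omega
      · simp only [TPTL.sat]
        rw [tau_sub, one_mem, div_eq_one_iff_eq hKr.ne']
        have : num K 0 (3 * K) - num K 0 K = 8 * K := by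
          unfold num; split_ifs <;> push_cast <;> omega
        rw [this]; push_cast; ring
    have p1 : ¬ TPTL.Models (wd K hK 1 (by omega) (by omega)) psi := by
      rintro ⟨i, _, hi, ⟨j, _, hj, h, _⟩, _⟩
      have hi2 : i < 4 * K := hi
      have hj2 : j < 4 * K := hj
      simp only [TPTL.sat] at h
      rw [tau_sub, one_mem, div_eq_one_iff_eq hKr.ne'] at h
      have h' : num K 1 j - num K 1 i = 8 * K := by exact_mod_cast h
      unfold num at h'
      split_ifs at h' <;> omega
    apply p1
    rw [a2]
    rw [a1] at p0
    have key := na_main K hK φ hn hna (dep φ) le_rfl hKe.ge 0 1 (by omega) (by omega) (by omega)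
      (by omega) 0 0 (by omega) (by omega) (fun I _ l hl => (cmem_same K hK 0 1 (by omega)
        (by omega) (by omega) (by omega) I 0 l (by omega) hl (by omega) (by omega)).1)
    rw [TimedWord.tau_zero, TimedWord.tau_zero] at key
    exact key p0

end Paper
end
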